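/- arXiv:2409.00619 — 5 statements merged into one kernel-verified Lean document; each statement's English description precedes it below -/
import Mathlib

section
/- Under Assumption 1, with Lipschitz initial data k̄ ∈ L^∞([0,∞);[0,∞)) and inflow distribution φ Lipschitz in space (locally uniformly in time), the unique strong solution k of the generalized bathtub model satisfies the characteristic representation formula k(t,x) = k̄(x + ξ(t)) + ∫₀ᵗ f(τ) φ(τ, x + ξ(t) − ξ(τ)) dτ for all t ∈ [0,∞) and x ≥ 0, where ξ(t) := ∫₀ᵗ V(∫₀^∞ k(τ,y) w(y) dy) dτ. -/
open MeasureTheory Set Function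

noncomputable section

/-- Assumption 1: `w ∈ L¹∩L^∞([0,∞);[0,∞))` with unit mass, `V` Lipschitz and
nonnegative on `[0,∞)`, `f ∈ L^∞([0,∞);[0,∞))`. -/
structure Assumption1 (w V f : ℝ → ℝ) : Prop where
  w_meas : Measurable w
  w_nonneg : ∀ y ∈ Ici (0:ℝ), 0 ≤ w y
  w_int : IntegrableOn w (Ici (0:ℝ))
  w_bdd : ∃ M : ℝ, ∀ y ∈ Ici (0:ℝ), w y ≤ M
  w_total : (∫ y in Ici (0:ℝ), w y) = 1
  V_lip : ∃ K : NNReal, LipschitzOnWith K V (Ici 0)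
  V_nonneg : ∀ s ∈ Ici (0:ℝ), 0 ≤ V s
  f_meas : Measurable f
  f_nonneg : ∀ t ∈ Ici (0:ℝ), 0 ≤ f t
  f_bdd : ∃ M : ℝ, ∀ t ∈ Ici (0:ℝ), f t ≤ M

/-- The nonlocal term `∫₀^∞ k(t,y) w(y) dy`. -/
def NonlocalTerm (w : ℝ → ℝ) (k : ℝ → ℝ → ℝ) (t : ℝ) : ℝ :=
  ∫ y in Ici (0:ℝ), k t y * w y

/-- A strong solution of the generalized bathtub model on `[0,∞)×[0,∞)`:
a Lipschitz continuous nonnegative function satisfying the equation pointwise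
together with the initial condition. -/
def IsStrongSolution (w V f kbar : ℝ → ℝ) (phi : ℝ → ℝ → ℝ) (k : ℝ → ℝ → ℝ) : Prop :=
  (∃ K : NNReal, LipschitzOnWith K (uncurry k) (Ici 0 ×ˢ Ici 0)) ∧
  (∀ t ∈ Ici (0:ℝ), ∀ x ∈ Ici (0:ℝ), 0 ≤ k t x) ∧
  (∀ x ∈ Ici (0:ℝ), k 0 x = kbar x) ∧
  (∀ t ∈ Ici (0:ℝ), ∀ x ∈ Ici (0:ℝ), ∃ kt kx : ℝ,
    HasDerivWithinAt (fun s => k s x) kt (Ici 0) t ∧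
    HasDerivWithinAt (fun y => k t y) kx (Ici 0) x ∧
    kt - V (NonlocalTerm w k t) * kx = f t * phi t x)

/-- `ξ(t) = ∫₀ᵗ V(∫₀^∞ k(τ,y)w(y) dy) dτ`. -/
def xiOf (w V : ℝ → ℝ) (k : ℝ → ℝ → ℝ) (t : ℝ) : ℝ :=
  ∫ τ in (0:ℝ)..t, V (NonlocalTerm w k τ)

/-- A Lipschitz function of two variables is differentiable at almost every point of almost every
translate of a fixed measurable curve. -/
theorem LipschitzWith.ae_ae_differentiableAt_shear {F : ℝ × ℝ → ℝ} {C : NNReal}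
    (hF : LipschitzWith C F) {c : ℝ → ℝ} (hc : Measurable c) :
    ∀ᵐ y : ℝ, ∀ᵐ s : ℝ, DifferentiableAt ℝ F (s, y - c s) := by
  have hshear : MeasurePreserving (fun p : ℝ × ℝ => (p.1, p.2 - c p.1)) := by
    refine (MeasurePreserving.id (volume : Measure ℝ)).skew_product
      (g := fun s y => y - c s) ?_ ?_
    · exact measurable_snd.sub (hc.comp measurable_fst)
    · exact ae_of_all _ fun s => (measurePreserving_sub_right volume (c s)).map_eq
  have hswap : MeasurePreserving (Prod.swap : ℝ × ℝ → ℝ × ℝ) := Measure.measurePreserving_swap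
  have h := (hshear.comp hswap).quasiMeasurePreserving.ae
    (hF.ae_differentiableAt (μ := (volume : Measure (ℝ × ℝ))))
  exact Measure.ae_ae_of_ae_prod h

/-- A Lipschitz function evaluated along a `C¹` curve `s ↦ (s, y - c s)` is recovered from its
almost everywhere defined derivative. -/
theorem LipschitzWith.integral_deriv_along_curve {F : ℝ × ℝ → ℝ} {C : NNReal}
    (hF : LipschitzWith C F) {c v : ℝ → ℝ} (hv : Continuous v)
    (hc : ∀ s, HasDerivAt c (v s) s) (y t : ℝ) :
    ∫ s in (0:ℝ)..t, deriv (fun s => F (s, y - c s)) s = F (t, y - c t) - F (0, y - c 0) := by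
  obtain ⟨B, hB⟩ := isCompact_uIcc.exists_bound_of_continuousOn (s := uIcc 0 t) hv.continuousOn
  have hcLip : LipschitzOnWith B.toNNReal c (uIcc 0 t) := by
    refine (convex_uIcc 0 t).lipschitzOnWith_of_nnnorm_deriv_le
      (fun s _ => (hc s).differentiableAt) fun s hs => ?_
    rw [(hc s).deriv]
    exact NNReal.coe_le_coe.1 ((hB s hs).trans (Real.le_coe_toNNReal B))
  have hcurve := (LipschitzWith.id.lipschitzOnWith (s := uIcc 0 t)).prodMk
    ((LipschitzWith.const y).lipschitzOnWith.sub hcLip)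
  exact ((hF.lipschitzOnWith (s := univ)).comp hcurve
    (mapsTo_univ _ _)).absolutelyContinuousOnInterval.integral_deriv_eq_sub

/-- At a point of differentiability, the derivative along a curve `s ↦ (s, y - c s)` is given by
the one-variable partial derivatives. -/
theorem DifferentiableAt.hasDerivAt_along_curve {F : ℝ × ℝ → ℝ} {c : ℝ → ℝ} {y s v a b : ℝ}
    (hF : DifferentiableAt ℝ F (s, y - c s)) (hc : HasDerivAt c v s)
    (ha : HasDerivAt (fun r => F (r, y - c s)) a s)
    (hb : HasDerivAt (fun z => F (s, z)) b (y - c s)) :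
    HasDerivAt (fun r => F (r, y - c r)) (a - v * b) s := by
  have hL := hF.hasFDerivAt
  set L := fderiv ℝ F (s, y - c s)
  have ha' : L (1, 0) = a :=
    (hL.comp_hasDerivAt s ((hasDerivAt_id s).prodMk (hasDerivAt_const s (y - c s)))).unique ha
  have hb' : L (0, 1) = b :=
    (hL.comp_hasDerivAt (y - c s)
      ((hasDerivAt_const (y - c s) s).prodMk (hasDerivAt_id (y - c s)))).unique hb
  have h := hL.comp_hasDerivAt s ((hasDerivAt_id s).prodMk (hc.const_sub y))
  have hsplit : ((1 : ℝ), -v) = (1, 0) - v • ((0 : ℝ), (1 : ℝ)) := by simp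
  rw [hsplit, map_sub, map_smul, ha', hb', smul_eq_mul] at h
  exact h

/-- If `k` is Lipschitz on the quadrant with `k 0` bounded and nonnegative, then the slices of `k`
are integrable against `w`. -/
theorem integrableOn_mul_weight {w : ℝ → ℝ} {k : ℝ → ℝ → ℝ} {K : NNReal} {M t : ℝ}
    (hw : IntegrableOn w (Ici 0))
    (hk : LipschitzOnWith K (uncurry k) (Ici 0 ×ˢ Ici 0))
    (hk0 : ∀ x ∈ Ici (0:ℝ), |k 0 x| ≤ M) (ht : 0 ≤ t) :
    IntegrableOn (fun y => k t y * w y) (Ici 0) := by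
  refine Integrable.bdd_mul (c := M + K * t) hw ?_ ?_
  · refine ContinuousOn.aestronglyMeasurable ?_ measurableSet_Ici
    exact hk.continuousOn.comp (f := fun y => (t, y)) (by fun_prop) fun y hy => ⟨ht, hy⟩
  · refine (ae_restrict_iff' measurableSet_Ici).2 (ae_of_all _ fun y hy => ?_)
    have h := hk.dist_le_mul (t, y) ⟨ht, hy⟩ (0, y) ⟨self_mem_Ici, hy⟩
    simp only [uncurry_apply_pair, Real.dist_eq, Prod.dist_eq, sub_zero, sub_self, abs_zero,
      abs_of_nonneg ht, max_eq_left ht] at h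
    have h' := abs_sub_abs_le_abs_sub (k t y) (k 0 y)
    have := hk0 y hy
    rw [Real.norm_eq_abs]
    linarith

theorem lipschitzOnWith_nonlocalTerm {w : ℝ → ℝ} {k : ℝ → ℝ → ℝ} {K : NNReal}
    (hw : IntegrableOn w (Ici 0)) (hw0 : ∀ y ∈ Ici (0:ℝ), 0 ≤ w y)
    (hw1 : (∫ y in Ici (0:ℝ), w y) = 1)
    (hk : LipschitzOnWith K (uncurry k) (Ici 0 ×ˢ Ici 0))
    (hint : ∀ t ∈ Ici (0:ℝ), IntegrableOn (fun y => k t y * w y) (Ici 0)) :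
    LipschitzOnWith K (NonlocalTerm w k) (Ici 0) := by
  refine LipschitzOnWith.of_dist_le_mul fun s hs t ht => ?_
  rw [Real.dist_eq, NonlocalTerm, NonlocalTerm, ← integral_sub (hint s hs) (hint t ht),
    ← Real.norm_eq_abs]
  have hbound : ∀ᵐ y ∂volume.restrict (Ici (0:ℝ)),
      ‖k s y * w y - k t y * w y‖ ≤ K * dist s t * w y := by
    refine (ae_restrict_iff' measurableSet_Ici).2 (ae_of_all _ fun y hy => ?_)
    have h := hk.dist_le_mul (s, y) ⟨hs, hy⟩ (t, y) ⟨ht, hy⟩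
    rw [Prod.dist_eq, dist_self, max_eq_left dist_nonneg, Real.dist_eq] at h
    rw [← sub_mul, norm_mul, Real.norm_eq_abs, Real.norm_of_nonneg (hw0 y hy)]
    exact mul_le_mul_of_nonneg_right h (hw0 y hy)
  refine (norm_integral_le_of_norm_le (hw.const_mul _) hbound).trans ?_
  rw [integral_const_mul, hw1, mul_one]

/-- Continuity of the accumulated inflow along characteristics in the characteristic label. -/
theorem continuousOn_integral_inflow {f c : ℝ → ℝ} {phi : ℝ → ℝ → ℝ} {t Mf Mphi : ℝ}
    (ht : 0 ≤ t) (hc : Measurable c) (hct : ∀ τ ∈ Icc 0 t, c τ ≤ c t)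
    (hf : Measurable f) (hfb : ∀ τ ∈ Icc 0 t, |f τ| ≤ Mf)
    (hphi : Measurable (uncurry phi)) (hphib : ∀ τ ∈ Icc 0 t, ∀ x ∈ Ici (0:ℝ), |phi τ x| ≤ Mphi)
    (hphic : ∀ τ ∈ Icc 0 t, ContinuousOn (phi τ) (Ici 0)) :
    ContinuousOn (fun y => ∫ τ in (0:ℝ)..t, f τ * phi τ (y - c τ)) (Ici (c t)) := by
  have hmem : ∀ y ∈ Ici (c t), ∀ τ ∈ Icc 0 t, y - c τ ∈ Ici (0:ℝ) := fun y hy τ hτ =>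
    sub_nonneg.2 ((hct τ hτ).trans hy)
  intro y hy
  refine intervalIntegral.continuousWithinAt_of_dominated_interval
    (bound := fun _ => Mf * Mphi) ?_ ?_ intervalIntegrable_const ?_
  · refine Filter.Eventually.of_forall fun z => Measurable.aestronglyMeasurable ?_
    exact hf.mul (hphi.comp (measurable_id.prodMk (measurable_const.sub hc)))
  · filter_upwards [self_mem_nhdsWithin] with z hz
    refine ae_of_all _ fun τ hτ => ?_
    rw [uIoc_of_le ht] at hτ
    have hτ' := Ioc_subset_Icc_self hτ
    rw [norm_mul]
    exact mul_le_mul (hfb τ hτ') (hphib τ hτ' _ (hmem z hz τ hτ')) (abs_nonneg _)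
      ((abs_nonneg _).trans (hfb τ hτ'))
  · refine ae_of_all _ fun τ hτ => ?_
    rw [uIoc_of_le ht] at hτ
    have hτ' := Ioc_subset_Icc_self hτ
    refine ContinuousWithinAt.mul continuousWithinAt_const ?_
    exact ((hphic τ hτ').comp (f := fun z => z - c τ) (by fun_prop)
      fun z hz => hmem z hz τ hτ') y hy

theorem stmt3
    (w V f kbar : ℝ → ℝ) (phi : ℝ → ℝ → ℝ) (k : ℝ → ℝ → ℝ)
    (hA : Assumption1 w V f)
    (hkbar_lip : ∃ K : NNReal, LipschitzOnWith K kbar (Ici 0))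
    (hkbar_nonneg : ∀ x ∈ Ici (0:ℝ), 0 ≤ kbar x)
    (hkbar_bdd : ∃ M : ℝ, ∀ x ∈ Ici (0:ℝ), kbar x ≤ M)
    (hphi_meas : Measurable (uncurry phi))
    (hphi_nonneg : ∀ t ∈ Ici (0:ℝ), ∀ x ∈ Ici (0:ℝ), 0 ≤ phi t x)
    (hphi_bdd : ∃ M : ℝ, ∀ t ∈ Ici (0:ℝ), ∀ x ∈ Ici (0:ℝ), phi t x ≤ M)
    (hphi_lip : ∀ T : ℝ, 0 < T → ∃ K : NNReal,
      ∀ t ∈ Icc (0:ℝ) T, LipschitzOnWith K (phi t) (Ici 0))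
    (hk : IsStrongSolution w V f kbar phi k) :
    ∀ t ∈ Ici (0:ℝ), ∀ x ∈ Ici (0:ℝ),
      k t x = kbar (x + xiOf w V k t) +
        ∫ τ in (0:ℝ)..t, f τ * phi τ (x + xiOf w V k t - xiOf w V k τ) := by
  obtain ⟨⟨K, hkLip⟩, hk_nonneg, hk0, hkeq⟩ := hk
  obtain ⟨Mk, hMk⟩ := hkbar_bdd
  obtain ⟨Mf, hMf⟩ := hA.f_bdd
  obtain ⟨Mphi, hMphi⟩ := hphi_bdd
  obtain ⟨KV, hV⟩ := hA.V_lip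
  have hint : ∀ t ∈ Ici (0:ℝ), IntegrableOn (fun y => k t y * w y) (Ici 0) := fun t ht =>
    integrableOn_mul_weight (M := Mk) hA.w_int hkLip
      (fun x hx => by rw [hk0 x hx, abs_of_nonneg (hkbar_nonneg x hx)]; exact hMk x hx) ht
  have hN_nonneg : ∀ t ∈ Ici (0:ℝ), NonlocalTerm w k t ∈ Ici 0 := fun t ht =>
    setIntegral_nonneg measurableSet_Ici fun y hy =>
      mul_nonneg (hk_nonneg t ht y hy) (hA.w_nonneg y hy)
  have hN := lipschitzOnWith_nonlocalTerm hA.w_int hA.w_nonneg hA.w_total hkLip hint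
  -- The speed, extended continuously to negative times.
  let v : ℝ → ℝ := fun s => V (NonlocalTerm w k (max s 0))
  have hv_eq : ∀ s ∈ Ici (0:ℝ), v s = V (NonlocalTerm w k s) := fun s hs => by
    simp only [v, max_eq_left (mem_Ici.1 hs)]
  have hv : Continuous v :=
    (hV.continuousOn.comp hN.continuousOn hN_nonneg).comp_continuous
      (by fun_prop) fun s => le_max_right s 0
  let c : ℝ → ℝ := fun s => ∫ τ in (0:ℝ)..s, v τ
  have hc : ∀ s, HasDerivAt c (v s) s := fun s => hv.integral_hasStrictDerivAt 0 s |>.hasDerivAt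
  have hc_meas : Measurable c :=
    (continuous_iff_continuousAt.2 fun s => (hc s).continuousAt).measurable
  have hc_mono : MonotoneOn c (Ici 0) := by
    refine monotoneOn_of_deriv_nonneg (convex_Ici 0)
      (fun s _ => (hc s).continuousAt.continuousWithinAt)
      (fun s _ => (hc s).differentiableAt.differentiableWithinAt) fun s hs => ?_
    rw [interior_Ici] at hs
    have hs' : s ∈ Ici (0:ℝ) := Ioi_subset_Ici_self hs
    rw [(hc s).deriv, hv_eq s hs']
    exact hA.V_nonneg _ (hN_nonneg s hs')
  have hxi : ∀ t ∈ Ici (0:ℝ), xiOf w V k t = c t := fun t ht =>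
    intervalIntegral.integral_congr fun s hs => by
      rw [uIcc_of_le ht] at hs
      exact (hv_eq s hs.1).symm
  have hc0 : c 0 = 0 := intervalIntegral.integral_same
  obtain ⟨F, hF, hFk⟩ := hkLip.extend_real
  have hFk' : ∀ t ∈ Ici (0:ℝ), ∀ x ∈ Ici (0:ℝ), k t x = F (t, x) := fun t ht x hx =>
    hFk (mk_mem_prod ht hx)
  intro t ht x hx
  have hct : ∀ τ ∈ Icc 0 t, c τ ≤ c t := fun τ hτ => hc_mono hτ.1 ht hτ.2
  have hct0 : 0 ≤ c t := hc0 ▸ hct 0 ⟨le_rfl, ht⟩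
  have hgood : ∀ᵐ y : ℝ, y ∈ Ioi (c t) →
      F (t, y - c t) = kbar y + ∫ τ in (0:ℝ)..t, f τ * phi τ (y - c τ) := by
    filter_upwards [hF.ae_ae_differentiableAt_shear hc_meas] with y hdiff hy
    have hy0 : y ∈ Ici (0:ℝ) := hct0.trans (le_of_lt hy)
    have hderiv : ∫ s in (0:ℝ)..t, deriv (fun s => F (s, y - c s)) s =
        ∫ τ in (0:ℝ)..t, f τ * phi τ (y - c τ) := by
      refine intervalIntegral.integral_congr_ae ?_
      filter_upwards [hdiff] with s hs hst
      rw [uIoc_of_le ht] at hst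
      have hpos : 0 < y - c s := sub_pos.2 ((hct s (Ioc_subset_Icc_self hst)).trans_lt hy)
      obtain ⟨a, b, ha, hb, hab⟩ := hkeq s hst.1.le (y - c s) hpos.le
      have ha' : HasDerivAt (fun r => F (r, y - c s)) a s :=
        (ha.hasDerivAt (Ici_mem_nhds hst.1)).congr_of_eventuallyEq <| by
          filter_upwards [Ici_mem_nhds hst.1] with r hr
          exact (hFk' r hr _ hpos.le).symm
      have hb' : HasDerivAt (fun z => F (s, z)) b (y - c s) :=
        (hb.hasDerivAt (Ici_mem_nhds hpos)).congr_of_eventuallyEq <| by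
          filter_upwards [Ici_mem_nhds hpos] with z hz
          exact (hFk' s hst.1.le z hz).symm
      rw [(hs.hasDerivAt_along_curve (hc s) ha' hb').deriv, hv_eq s hst.1.le, hab]
    have h := hF.integral_deriv_along_curve hv hc y t
    rw [hderiv, hc0, sub_zero, ← hFk' 0 self_mem_Ici y hy0, hk0 y hy0] at h
    linarith
  obtain ⟨Kphi, hKphi⟩ := hphi_lip (t + 1) (add_pos_of_nonneg_of_pos ht one_pos)
  have hRHS : ContinuousOn
      (fun y => kbar y + ∫ τ in (0:ℝ)..t, f τ * phi τ (y - c τ)) (Ici (c t)) := by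
    refine ContinuousOn.add ?_ ?_
    · obtain ⟨Kk, hKk⟩ := hkbar_lip
      exact hKk.continuousOn.mono (Ici_subset_Ici.2 hct0)
    · refine continuousOn_integral_inflow (Mf := Mf) (Mphi := Mphi) ht hc_meas hct hA.f_meas
        (fun τ hτ => ?_) hphi_meas (fun τ hτ x hx => ?_) fun τ hτ => ?_
      · rw [abs_of_nonneg (hA.f_nonneg τ hτ.1)]
        exact hMf τ hτ.1
      · rw [abs_of_nonneg (hphi_nonneg τ hτ.1 x hx)]
        exact hMphi τ hτ.1 x hx
      · exact (hKphi τ ⟨hτ.1, hτ.2.trans (le_add_of_nonneg_right zero_le_one)⟩).continuousOn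
  have hLHS : Continuous fun y => F (t, y - c t) := hF.continuous.comp (by fun_prop)
  have hae : (fun y => F (t, y - c t)) =ᵐ[volume.restrict (Ici (c t))]
      fun y => kbar y + ∫ τ in (0:ℝ)..t, f τ * phi τ (y - c τ) := by
    rw [← restrict_Ioi_eq_restrict_Ici]
    exact (ae_restrict_iff' measurableSet_Ioi).2 hgood
  have heq := Measure.eqOn_of_ae_eq hae hLHS.continuousOn hRHS
    (by rw [interior_Ici, closure_Ioi]) (show x + c t ∈ Ici (c t) from
      mem_Ici.2 (le_add_of_nonneg_left hx))
  simp only [add_sub_cancel_right] at heq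
  rw [hFk' t ht x hx, hxi t ht, heq]
  congr 1
  refine intervalIntegral.integral_congr fun τ hτ => ?_
  rw [uIcc_of_le ht] at hτ
  simp only [hxi τ hτ.1]
end
end

section
/- Under Assumption 1, with Lipschitz initial data k̄ ∈ L^∞([0,∞);[0,∞)) and inflow distribution φ Lipschitz in space (locally uniformly in time), the strong solution k of the generalized bathtub model satisfies, for every t ∈ [0,∞): ‖k(t,·)‖_{L^∞([0,∞))} ≤ ‖k̄‖_{L^∞} + sup_{τ∈[0,t]} ‖φ(τ,·)‖_{L^∞} · ∫₀ᵗ f(τ) dτ, and ‖∂_x k(t,·)‖_{L^∞([0,∞))} ≤ ‖k̄'‖_{L^∞} + sup_{τ∈[0,t]} ‖∂_x φ(τ,·)‖_{L^∞} · ∫₀ᵗ f(τ) dτ. -/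
open MeasureTheory Set Function

noncomputable section

open Filter Topology in
/-- A continuous function whose averages over all intervals `[0, h]` are at most `C` is at most `C`
at `0`. -/
theorem apply_zero_le_of_integral_le {u : ℝ → ℝ} (hu : Continuous u) {C : ℝ}
    (h : ∀ r > 0, ∫ y in (0:ℝ)..r, u y ≤ r * C) : u 0 ≤ C := by
  by_contra! hC
  obtain ⟨d, hd, hball⟩ := Metric.eventually_nhds_iff.1
    (hu.continuousAt.eventually (lt_mem_nhds (show (C + u 0) / 2 < u 0 by linarith)))
  have hlow : ∫ _ in (0:ℝ)..(d / 2), (C + u 0) / 2 ≤ ∫ y in (0:ℝ)..(d / 2), u y := by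
    refine intervalIntegral.integral_mono_on (by positivity) (by simp)
      (hu.intervalIntegrable _ _) fun y hy => (hball ?_).le
    rw [Real.dist_eq, sub_zero, abs_of_nonneg hy.1]
    linarith [hy.2]
  have hup := h (d / 2) (by positivity)
  rw [intervalIntegral.integral_const, sub_zero, smul_eq_mul] at hlow
  nlinarith

theorem continuous_uncurry_of_abs_sub_le {q : ℝ → ℝ → ℝ} {L : ℝ}
    (hL : ∀ s s' y y', |q s y - q s' y'| ≤ L * (|s - s'| + |y - y'|)) :
    Continuous (uncurry q) := by
  have hL0 : 0 ≤ L := by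
    have := (abs_nonneg _).trans (hL 1 0 0 0)
    simpa using this
  refine (LipschitzWith.of_dist_le_mul (K := ⟨2 * L, by positivity⟩) fun a b => ?_).continuous
  rw [Real.dist_eq]
  refine (hL a.1 b.1 a.2 b.2).trans ?_
  have h1 : |a.1 - b.1| ≤ dist a b := by
    rw [← Real.dist_eq, Prod.dist_eq]; exact le_max_left _ _
  have h2 : |a.2 - b.2| ≤ dist a b := by
    rw [← Real.dist_eq, Prod.dist_eq]; exact le_max_right _ _
  change _ ≤ 2 * L * dist a b
  nlinarith

/-- Differentiation under the integral sign for a Lipschitz function satisfying, at time `s`, the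
transport equation `∂ₜ q - v ∂ₓ q = F` pointwise on the open half-line. -/
theorem hasDerivAt_integral_of_transport {q : ℝ → ℝ → ℝ} {L : ℝ}
    (hL : ∀ s s' y y', |q s y - q s' y'| ≤ L * (|s - s'| + |y - y'|))
    {s v : ℝ} {F : ℝ → ℝ} (hF : ContinuousOn F (Ici 0))
    (heq : ∀ y > 0, ∃ qt qx : ℝ, HasDerivAt (fun s' => q s' y) qt s ∧
      HasDerivAt (q s) qx y ∧ qt - v * qx = F y)
    {a h : ℝ} (ha : 0 ≤ a) (hh : 0 ≤ h) :
    HasDerivAt (fun s' => ∫ y in a..a + h, q s' y)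
      (v * (q s (a + h) - q s a) + ∫ y in a..a + h, F y) s := by
  have hcont := continuous_uncurry_of_abs_sub_le hL
  have hq : ∀ s', Continuous (q s') := fun s' => hcont.comp (by fun_prop : Continuous (Prod.mk s'))
  have hL0 : 0 ≤ L := by
    have := (abs_nonneg _).trans (hL 1 0 0 0)
    simpa using this
  have hmem : ∀ y ∈ uIoc a (a + h), 0 < y := fun y hy => by
    rw [uIoc_of_le (by linarith)] at hy
    exact ha.trans_lt hy.1
  have hFint : IntervalIntegrable F volume a (a + h) := by
    refine ContinuousOn.intervalIntegrable (hF.mono ?_)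
    rw [uIcc_of_le (by linarith)]
    exact fun y hy => ha.trans hy.1
  have hderiv_int : IntervalIntegrable (deriv (q s)) volume a (a + h) := by
    refine (intervalIntegrable_const (c := L)).mono_fun
      (measurable_deriv _).aestronglyMeasurable (ae_of_all _ fun y => ?_)
    rw [Real.norm_of_nonneg hL0]
    refine norm_deriv_le_of_lip' hL0 (Filter.Eventually.of_forall fun z => ?_)
    simpa using hL s s z y
  have hftc : ∫ y in a..a + h, deriv (q s) y = q s (a + h) - q s a := by
    refine intervalIntegral.integral_eq_sub_of_hasDerivAt_of_le (by linarith)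
      (hq s).continuousOn (fun y hy => ?_) hderiv_int
    obtain ⟨_, _, _, hx, _⟩ := heq y (ha.trans_lt hy.1)
    exact hx.differentiableAt.hasDerivAt
  have key := (intervalIntegral.hasDerivAt_integral_of_dominated_loc_of_lip (μ := volume)
    (F := q) (F' := fun y => v * deriv (q s) y + F y) (x₀ := s) (a := a) (b := a + h)
    (bound := fun _ => L) Filter.univ_mem
    (Filter.Eventually.of_forall fun s' => (hq s').aestronglyMeasurable)
    ((hq s).intervalIntegrable _ _)
    (intervalIntegrable_iff.1 ((hderiv_int.const_mul v).add hFint)).1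
    (ae_of_all _ fun y _ => LipschitzOnWith.of_dist_le_mul fun s₁ _ s₂ _ => ?_)
    intervalIntegrable_const
    (ae_of_all _ fun y hy => ?_)).2
  · rwa [intervalIntegral.integral_add (hderiv_int.const_mul v) hFint,
      intervalIntegral.integral_const_mul, hftc] at key
  · rw [Real.coe_nnabs, abs_of_nonneg hL0, Real.dist_eq, Real.dist_eq]
    simpa using hL s₁ s₂ y y
  · obtain ⟨qt, qx, ht, hx, he⟩ := heq y (hmem y hy)
    refine ht.congr_deriv ?_
    rw [hx.deriv]
    linarith

open Filter Topology Asymptotics in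
/-- Local averages of a Lipschitz function satisfying the transport equation at time `s` have the
expected derivative along a characteristic. -/
theorem hasDerivAt_integral_along_characteristic {q : ℝ → ℝ → ℝ} {L : ℝ}
    (hL : ∀ s s' y y', |q s y - q s' y'| ≤ L * (|s - s'| + |y - y'|))
    {s v : ℝ} {F : ℝ → ℝ} (hF : ContinuousOn F (Ici 0))
    (heq : ∀ y > 0, ∃ qt qx : ℝ, HasDerivAt (fun s' => q s' y) qt s ∧
      HasDerivAt (q s) qx y ∧ qt - v * qx = F y)
    {X : ℝ → ℝ} (hX : HasDerivAt X (-v) s) (hXs : 0 ≤ X s) {h : ℝ} (hh : 0 ≤ h) :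
    HasDerivAt (fun s' => ∫ y in (0:ℝ)..h, q s' (X s' + y)) (∫ y in (0:ℝ)..h, F (X s + y)) s := by
  have hcont := continuous_uncurry_of_abs_sub_le hL
  have hq : ∀ s', Continuous (q s') := fun s' => hcont.comp (by fun_prop : Continuous (Prod.mk s'))
  have hA := hasDerivAt_integral_of_transport hL hF heq hXs hh
  set P : ℝ → ℝ := fun b => ∫ y in (0:ℝ)..b, q s y with hP
  have hPd : ∀ b, HasDerivAt P (q s b) b := fun b =>
    ((hq s).integral_hasStrictDerivAt 0 b).hasDerivAt
  have hC : HasDerivAt (fun s' => P (X s' + h) - P (X s')) (q s (X s + h) * -v - q s (X s) * -v) s :=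
    ((hPd _).comp s (hX.add_const h)).sub ((hPd _).comp s hX)
  set R : ℝ → ℝ := fun s' => ∫ y in (X s)..(X s'),
    ((q s' (y + h) - q s (y + h)) - (q s' y - q s y)) with hR
  have hRd : HasDerivAt R 0 s := by
    rw [hasDerivAt_iff_isLittleO]
    have hbound : ∀ s', |R s'| ≤ 2 * L * |(s' - s) * (X s' - X s)| := fun s' => by
      have := intervalIntegral.norm_integral_le_of_norm_le_const (a := X s) (b := X s')
        (C := 2 * L * |s' - s|)
        (f := fun y => (q s' (y + h) - q s (y + h)) - (q s' y - q s y)) fun y _ => by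
          have h1 := hL s' s (y + h) (y + h)
          have h2 := hL s' s y y
          have h3 := abs_sub (q s' (y + h) - q s (y + h)) (q s' y - q s y)
          simp only [sub_self, abs_zero, add_zero] at h1 h2
          rw [Real.norm_eq_abs]
          linarith
      rw [abs_mul, ← mul_assoc]
      exact this
    have hbig : R =O[𝓝 s] fun s' => (s' - s) * (X s' - X s) :=
      IsBigO.of_bound (2 * L) (Eventually.of_forall hbound)
    have hsmall : (fun s' => X s' - X s) =o[𝓝 s] fun _ => (1:ℝ) := by
      rw [isLittleO_one_iff]
      simpa using hX.continuousAt.tendsto.sub_const (X s)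
    have := hbig.trans_isLittleO ((isBigO_refl (fun s' : ℝ => s' - s) (𝓝 s)).mul_isLittleO hsmall)
    simpa [hR] using this
  have hsum := (hA.add hC).add hRd
  have hint : ∀ s' a b, IntervalIntegrable (q s') volume a b :=
    fun s' a b => (hq s').intervalIntegrable a b
  have hshift : ∀ s' : ℝ, IntervalIntegrable (fun y => q s' (y + h)) volume (X s) (X s') :=
    fun s' => Continuous.intervalIntegrable (by have := hq s'; fun_prop) _ _
  have hdecomp : ∀ s', ∫ y in (0:ℝ)..h, q s' (X s' + y) =
      (∫ y in X s..X s + h, q s' y) + (P (X s' + h) - P (X s')) + R s'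
        - (P (X s + h) - P (X s)) := fun s' => by
    have hRs : R s' = ((∫ y in (X s + h)..(X s' + h), q s' y)
        - ∫ y in (X s + h)..(X s' + h), q s y)
        - ((∫ y in (X s)..(X s'), q s' y) - ∫ y in (X s)..(X s'), q s y) := by
      rw [hR]
      dsimp only
      rw [intervalIntegral.integral_sub ((hshift s').sub
          (Continuous.intervalIntegrable (by have := hq s; fun_prop) _ _))
          ((hint _ _ _).sub (hint _ _ _)),
        intervalIntegral.integral_sub (hshift s')
          (Continuous.intervalIntegrable (by have := hq s; fun_prop) _ _),
        intervalIntegral.integral_sub (hint _ _ _) (hint _ _ _),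
        intervalIntegral.integral_comp_add_right (q s'),
        intervalIntegral.integral_comp_add_right (q s)]
    rw [intervalIntegral.integral_comp_add_left (q s'), add_zero, hRs]
    have e (r a b : ℝ) : ∫ y in a..b, q r y = (∫ y in (0:ℝ)..b, q r y) - ∫ y in (0:ℝ)..a, q r y :=
      (intervalIntegral.integral_interval_sub_left (hint _ _ _) (hint _ _ _)).symm
    rw [e s' (X s'), e s' (X s), e s' (X s + h), e s (X s + h), e s' (X s), e s (X s)]
    simp only [hP]
    ring
  have hfun : (fun s' => ∫ y in (0:ℝ)..h, q s' (X s' + y)) = fun s' =>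
      (∫ y in X s..X s + h, q s' y) + (P (X s' + h) - P (X s')) + R s'
        - (P (X s + h) - P (X s)) := funext hdecomp
  rw [hfun, intervalIntegral.integral_comp_add_left F, add_zero]
  refine (hsum.sub_const _).congr_deriv ?_
  ring

theorem abs_sub_le_of_lipschitzOnWith_uncurry {k : ℝ → ℝ → ℝ} {K : NNReal}
    (hK : LipschitzOnWith K (uncurry k) (Ici 0 ×ˢ Ici 0)) (s s' y y' : ℝ) :
    |k (max s 0) (max y 0) - k (max s' 0) (max y' 0)| ≤ K * (|s - s'| + |y - y'|) := by
  have := hK.dist_le_mul (max s 0, max y 0)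
    ⟨mem_Ici.2 (le_max_right _ _), mem_Ici.2 (le_max_right _ _)⟩
    (max s' 0, max y' 0) ⟨mem_Ici.2 (le_max_right _ _), mem_Ici.2 (le_max_right _ _)⟩
  rw [Real.dist_eq, Prod.dist_eq, Real.dist_eq, Real.dist_eq] at this
  refine this.trans (mul_le_mul_of_nonneg_left (max_le ?_ ?_) K.coe_nonneg)
  · exact (abs_max_sub_max_le_abs s s' 0).trans (le_add_of_nonneg_right (abs_nonneg _))
  · exact (abs_max_sub_max_le_abs y y' 0).trans (le_add_of_nonneg_left (abs_nonneg _))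

/-- The velocity of a strong solution with bounded initial datum is continuous and nonnegative
(the time variable being clamped to `[0,∞)`). -/
theorem IsStrongSolution.velocity_continuous_and_nonneg {w V f kbar : ℝ → ℝ} {phi k : ℝ → ℝ → ℝ}
    (hA : Assumption1 w V f) (hkbar_bdd : ∃ M : ℝ, ∀ x ∈ Ici (0:ℝ), kbar x ≤ M)
    (hk : IsStrongSolution w V f kbar phi k) :
    Continuous (fun s => V (NonlocalTerm w k (max s 0))) ∧
      ∀ s, 0 ≤ V (NonlocalTerm w k (max s 0)) := by
  obtain ⟨⟨K, hK⟩, hk0, hinit, -⟩ := hk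
  obtain ⟨M, hM⟩ := hkbar_bdd
  obtain ⟨KV, hV⟩ := hA.V_lip
  have hL := abs_sub_le_of_lipschitzOnWith_uncurry hK
  have hq : ∀ s, Continuous fun y => k (max s 0) (max y 0) := fun s =>
    (continuous_uncurry_of_abs_sub_le
      (q := fun s y => k (max s 0) (max y 0)) hL).comp (by fun_prop : Continuous (Prod.mk s))
  have hterm : ∀ s, NonlocalTerm w k (max s 0) =
      ∫ y in Ici (0:ℝ), k (max s 0) (max y 0) * w y := fun s =>
    setIntegral_congr_fun measurableSet_Ici fun y hy => by
      simp only [max_eq_left (mem_Ici.1 hy)]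
  have hint : ∀ s, IntegrableOn (fun y => k (max s 0) (max y 0) * w y) (Ici 0) := fun s => by
    refine Integrable.bdd_mul (c := M + K * |s|) hA.w_int (hq s).aestronglyMeasurable
      (ae_of_all _ fun y => ?_)
    rw [Real.norm_of_nonneg (hk0 _ (mem_Ici.2 (le_max_right _ _)) _ (mem_Ici.2 (le_max_right _ _)))]
    have h1 := hL s 0 y y
    have h2 := hM (max y 0) (mem_Ici.2 (le_max_right _ _))
    rw [← hinit _ (mem_Ici.2 (le_max_right _ _))] at h2
    simp only [sub_zero, sub_self, abs_zero, add_zero, max_self] at h1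
    linarith [le_abs_self (k (max s 0) (max y 0) - k 0 (max y 0))]
  have hN0 : ∀ s, 0 ≤ NonlocalTerm w k (max s 0) := fun s =>
    setIntegral_nonneg measurableSet_Ici fun y hy =>
      mul_nonneg (hk0 _ (mem_Ici.2 (le_max_right _ _)) _ hy) (hA.w_nonneg y hy)
  have hNc : Continuous fun s => NonlocalTerm w k (max s 0) := by
    refine (LipschitzWith.of_dist_le_mul (K := K) fun s s' => ?_).continuous
    rw [Real.dist_eq, Real.dist_eq, hterm, hterm, ← integral_sub (hint s) (hint s')]
    have hb : ∀ y ∈ Ici (0:ℝ), ‖k (max s 0) (max y 0) * w y - k (max s' 0) (max y 0) * w y‖ ≤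
        K * |s - s'| * w y := fun y hy => by
      have h1 := hL s s' y y
      simp only [sub_self, abs_zero, add_zero] at h1
      rw [← sub_mul, norm_mul, Real.norm_eq_abs, Real.norm_of_nonneg (hA.w_nonneg y hy)]
      exact mul_le_mul_of_nonneg_right h1 (hA.w_nonneg y hy)
    have := norm_integral_le_of_norm_le (hA.w_int.const_mul (K * |s - s'|))
      ((ae_restrict_iff' measurableSet_Ici).2 (ae_of_all _ hb))
    rwa [integral_const_mul, hA.w_total, mul_one] at this
  refine ⟨?_, fun s => hA.V_nonneg _ (hN0 s)⟩
  exact hV.continuousOn.comp_continuous hNc hN0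

theorem stmt4
    (w V f kbar : ℝ → ℝ) (phi : ℝ → ℝ → ℝ) (k : ℝ → ℝ → ℝ)
    (hA : Assumption1 w V f)
    (hkbar_lip : ∃ K : NNReal, LipschitzOnWith K kbar (Ici 0))
    (hkbar_nonneg : ∀ x ∈ Ici (0:ℝ), 0 ≤ kbar x)
    (hkbar_bdd : ∃ M : ℝ, ∀ x ∈ Ici (0:ℝ), kbar x ≤ M)
    (hphi_meas : Measurable (uncurry phi))
    (hphi_nonneg : ∀ t ∈ Ici (0:ℝ), ∀ x ∈ Ici (0:ℝ), 0 ≤ phi t x)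
    (hphi_bdd : ∃ M : ℝ, ∀ t ∈ Ici (0:ℝ), ∀ x ∈ Ici (0:ℝ), phi t x ≤ M)
    (hphi_lip : ∀ T : ℝ, 0 < T → ∃ K : NNReal,
      ∀ t ∈ Icc (0:ℝ) T, LipschitzOnWith K (phi t) (Ici 0))
    (hk : IsStrongSolution w V f kbar phi k) :
    ∀ t ∈ Ici (0:ℝ),
      -- ‖k(t,·)‖_{L^∞} ≤ ‖k̄‖_{L^∞} + sup_{τ∈[0,t]}‖φ(τ,·)‖_{L^∞} ∫₀ᵗ f(τ)dτ
      (∀ Mk Mp : ℝ, (∀ x ∈ Ici (0:ℝ), kbar x ≤ Mk) →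
        (∀ τ ∈ Icc (0:ℝ) t, ∀ x ∈ Ici (0:ℝ), phi τ x ≤ Mp) →
        ∀ x ∈ Ici (0:ℝ), k t x ≤ Mk + Mp * ∫ τ in (0:ℝ)..t, f τ)
      -- ‖∂ₓk(t,·)‖_{L^∞} ≤ ‖k̄'‖_{L^∞} + sup_{τ∈[0,t]}‖∂ₓφ(τ,·)‖_{L^∞} ∫₀ᵗ f(τ)dτ,
      -- expressed through Lipschitz constants in the space variable
      ∧ (∀ Kk Kp : ℝ, 0 ≤ Kk → 0 ≤ Kp →
        (∀ x ∈ Ici (0:ℝ), ∀ y ∈ Ici (0:ℝ), |kbar x - kbar y| ≤ Kk * |x - y|) →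
        (∀ τ ∈ Icc (0:ℝ) t, ∀ x ∈ Ici (0:ℝ), ∀ y ∈ Ici (0:ℝ),
          |phi τ x - phi τ y| ≤ Kp * |x - y|) →
        ∀ x ∈ Ici (0:ℝ), ∀ y ∈ Ici (0:ℝ),
          |k t x - k t y| ≤ (Kk + Kp * ∫ τ in (0:ℝ)..t, f τ) * |x - y|) := by
  obtain ⟨hvc, hv0⟩ := hk.velocity_continuous_and_nonneg hA hkbar_bdd
  obtain ⟨⟨K, hK⟩, -, hinit, heq⟩ := hk
  intro t ht
  have ht0 : (0:ℝ) ≤ t := ht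
  have hL := abs_sub_le_of_lipschitzOnWith_uncurry hK
  set q : ℝ → ℝ → ℝ := fun s y => k (max s 0) (max y 0) with hqdef
  set v : ℝ → ℝ := fun s => V (NonlocalTerm w k (max s 0)) with hvdef
  have hqk : ∀ s ≥ 0, ∀ y ≥ 0, q s y = k s y := fun s hs y hy => by
    simp only [hqdef, max_eq_left hs, max_eq_left hy]
  have hqc : Continuous (uncurry q) := continuous_uncurry_of_abs_sub_le hL
  set X : ℝ → ℝ → ℝ := fun x s => x + ∫ r in s..t, v r with hXdef
  have hXd : ∀ x s, HasDerivAt (X x) (-v s) s := fun x s =>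
    (intervalIntegral.integral_hasDerivAt_left (hvc.intervalIntegrable _ _)
      (hvc.stronglyMeasurableAtFilter _ _) hvc.continuousAt).const_add x
  have hXc : ∀ x, Continuous (X x) := fun x =>
    continuous_iff_continuousAt.2 fun s => (hXd x s).continuousAt
  have hXx : ∀ x, ∀ s ≤ t, x ≤ X x s := fun x s hs =>
    le_add_of_nonneg_right (intervalIntegral.integral_nonneg hs fun r _ => hv0 r)
  have hXt : ∀ x, X x t = x := fun x => by simp [hXdef]
  have hphic : ∀ s ∈ Icc (0:ℝ) t, ContinuousOn (phi s) (Ici 0) := fun s hs => by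
    obtain ⟨Kp, hKp⟩ := hphi_lip (t + 1) (by linarith)
    exact (hKp s ⟨hs.1, by linarith [hs.2]⟩).continuousOn
  have hphii : ∀ s ∈ Icc (0:ℝ) t, ∀ x ≥ 0, ∀ r > 0,
      IntervalIntegrable (fun y => phi s (X x s + y)) volume 0 r := fun s hs x hx r hr => by
    refine ContinuousOn.intervalIntegrable ((hphic s hs).comp (by fun_prop) fun y hy => ?_)
    rw [uIcc_of_le hr.le] at hy
    exact add_nonneg (hx.trans (hXx x s hs.2)) hy.1
  set g : ℝ → ℝ → ℝ → ℝ := fun r x s => ∫ y in (0:ℝ)..r, q s (X x s + y) with hgdef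
  have hqX : ∀ x s, Continuous fun y => q s (X x s + y) := fun x s =>
    hqc.comp (by fun_prop : Continuous fun y => (s, X x s + y))
  have hgc : ∀ r x, Continuous (g r x) := fun r x =>
    intervalIntegral.continuous_parametric_intervalIntegral_of_continuous'
      (f := fun s y => q s (X x s + y))
      (hqc.comp (by have := hXc x; fun_prop :
        Continuous fun p : ℝ × ℝ => (p.1, X x p.1 + p.2))) 0 r
  have hgd : ∀ r > 0, ∀ x ≥ 0, ∀ s ∈ Ioo 0 t,
      HasDerivAt (g r x) (f s * ∫ y in (0:ℝ)..r, phi s (X x s + y)) s := fun r hr x hx s hs => by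
    rw [← intervalIntegral.integral_const_mul]
    refine hasDerivAt_integral_along_characteristic (F := fun y => f s * phi s y) hL
      (continuousOn_const.mul (hphic s ⟨hs.1.le, hs.2.le⟩)) (fun y hy => ?_) (hXd x s)
      (hx.trans (hXx x s hs.2.le)) hr.le
    obtain ⟨kt, kx, hkt, hkx, he⟩ := heq s hs.1.le y hy.le
    refine ⟨kt, kx, ?_, ?_, ?_⟩
    · refine (hkt.hasDerivAt (Ici_mem_nhds hs.1)).congr_of_eventuallyEq ?_
      filter_upwards [Ici_mem_nhds hs.1] with s' hs'
      exact hqk s' hs' y hy.le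
    · refine (hkx.hasDerivAt (Ici_mem_nhds hy)).congr_of_eventuallyEq ?_
      filter_upwards [Ici_mem_nhds hy] with y' hy'
      exact hqk s hs.1.le y' hy'
    · simpa only [hvdef, max_eq_left hs.1.le] using he
  have hfi : IntegrableOn f (Icc 0 t) := by
    obtain ⟨M, hM⟩ := hA.f_bdd
    refine Measure.integrableOn_of_bounded (M := M) (by simp)
      hA.f_meas.aestronglyMeasurable ?_
    refine (ae_restrict_iff' measurableSet_Icc).2 (ae_of_all _ fun s hs => ?_)
    rw [Real.norm_of_nonneg (hA.f_nonneg s hs.1)]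
    exact hM s hs.1
  refine ⟨fun Mk Mp hMk hMp x hx => ?_, fun Kk Kp hKk hKp hlip hplip => ?_⟩
  · have hx0 : (0:ℝ) ≤ x := hx
    rw [← hqk t ht x hx]
    have hcx : Continuous fun y => q t (x + y) :=
      hqc.comp (by fun_prop : Continuous fun y => (t, x + y))
    have := apply_zero_le_of_integral_le hcx (C := Mk + Mp * ∫ τ in (0:ℝ)..t, f τ) fun r hr => ?_
    · simpa using this
    have hmvt := intervalIntegral.sub_le_integral_of_hasDeriv_right_of_le ht0
      (hgc r x).continuousOn (fun s hs => (hgd r hr x hx s hs).hasDerivWithinAt)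
      (hfi.mul_const (r * Mp)) fun s hs => by
        refine mul_le_mul_of_nonneg_left ?_ (hA.f_nonneg s hs.1.le)
        have := intervalIntegral.integral_mono_on hr.le
          (hphii s ⟨hs.1.le, hs.2.le⟩ x hx r hr) (intervalIntegrable_const (c := Mp))
          fun y hy => hMp s ⟨hs.1.le, hs.2.le⟩ _ (add_nonneg (hx0.trans (hXx x s hs.2.le)) hy.1)
        simpa using this
    rw [intervalIntegral.integral_mul_const] at hmvt
    have h0 : g r x 0 ≤ r * Mk := by
      have := intervalIntegral.integral_mono_on hr.le
        ((hqX x 0).intervalIntegrable (μ := volume) 0 r) (intervalIntegrable_const (c := Mk))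
        fun y hy => by
          have hp := add_nonneg (hx0.trans (hXx x 0 ht0)) hy.1
          rw [hqk 0 le_rfl _ hp, hinit _ hp]
          exact hMk _ hp
      rwa [intervalIntegral.integral_const, sub_zero, smul_eq_mul] at this
    have hgt : g r x t = ∫ y in (0:ℝ)..r, q t (x + y) := by simp only [hgdef, hXt]
    rw [← hgt]
    linarith
  · have hside : ∀ x ≥ 0, ∀ x' ≥ 0,
        k t x - k t x' ≤ (Kk + Kp * ∫ τ in (0:ℝ)..t, f τ) * |x - x'| := fun x hx x' hx' => by
      rw [← hqk t ht x hx, ← hqk t ht x' hx']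
      have hc : ∀ z, Continuous fun y => q t (z + y) := fun z =>
        hqc.comp (by fun_prop : Continuous fun y => (t, z + y))
      have hXX : ∀ s y, X x s + y - (X x' s + y) = x - x' := fun s y => by
        simp only [hXdef]; ring
      have := apply_zero_le_of_integral_le ((hc x).sub (hc x'))
        (C := (Kk + Kp * ∫ τ in (0:ℝ)..t, f τ) * |x - x'|) fun r hr => ?_
      · simpa using this
      have hmvt := intervalIntegral.sub_le_integral_of_hasDeriv_right_of_le ht0
        ((hgc r x).sub (hgc r x')).continuousOn
        (fun s hs => ((hgd r hr x hx s hs).sub (hgd r hr x' hx' s hs)).hasDerivWithinAt)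
        (hfi.mul_const (r * (Kp * |x - x'|))) fun s hs => by
          have hs' : s ∈ Icc 0 t := ⟨hs.1.le, hs.2.le⟩
          rw [← mul_sub, ← intervalIntegral.integral_sub (hphii s hs' x hx r hr)
            (hphii s hs' x' hx' r hr)]
          refine mul_le_mul_of_nonneg_left ?_ (hA.f_nonneg s hs.1.le)
          have := intervalIntegral.integral_mono_on hr.le
            ((hphii s hs' x hx r hr).sub (hphii s hs' x' hx' r hr))
            (intervalIntegrable_const (μ := volume) (c := Kp * |x - x'|))
            fun y hy => by
              have := hplip s hs' _ (add_nonneg (hx.trans (hXx x s hs.2.le)) hy.1)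
                _ (add_nonneg (hx'.trans (hXx x' s hs.2.le)) hy.1)
              rw [hXX] at this
              exact (le_abs_self _).trans this
          rwa [intervalIntegral.integral_const, sub_zero, smul_eq_mul] at this
      rw [intervalIntegral.integral_mul_const] at hmvt
      have h0 : g r x 0 - g r x' 0 ≤ r * (Kk * |x - x'|) := by
        have := intervalIntegral.integral_mono_on hr.le
          (((hqX x 0).sub (hqX x' 0)).intervalIntegrable (μ := volume) 0 r)
          (intervalIntegrable_const (c := Kk * |x - x'|))
          fun y hy => by
            have hp := add_nonneg (hx.trans (hXx x 0 ht0)) hy.1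
            have hp' := add_nonneg (hx'.trans (hXx x' 0 ht0)) hy.1
            have := hlip _ hp _ hp'
            rw [hXX] at this
            rw [← hinit _ hp, ← hinit _ hp', ← hqk 0 le_rfl _ hp, ← hqk 0 le_rfl _ hp'] at this
            exact (le_abs_self _).trans this
        simp only [Pi.sub_apply] at this
        rw [intervalIntegral.integral_sub ((hqX x 0).intervalIntegrable 0 r)
          ((hqX x' 0).intervalIntegrable 0 r), intervalIntegral.integral_const, sub_zero,
          smul_eq_mul] at this
        exact this
      have hgt : ∀ z, g r z t = ∫ y in (0:ℝ)..r, q t (z + y) := fun z => by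
        simp only [hgdef, hXt]
      simp only [Pi.sub_apply] at hmvt ⊢
      rw [intervalIntegral.integral_sub ((hc x).intervalIntegrable 0 r)
        ((hc x').intervalIntegrable 0 r), ← hgt, ← hgt]
      linarith
    intro x hx x' hx'
    rw [abs_le]
    have h1 := hside x hx x' hx'
    have h2 := hside x' hx' x hx
    rw [abs_sub_comm] at h2
    constructor <;> linarith
end
end

section
/- Let Assumption 2 hold and f ∈ L^∞([0,T];[0,∞)), and let k be the strong solution of the generalized bathtub model on [0,T]×[0,∞). Then k(t,·) is supported on [0,L] for every t ∈ [0,T], and the total mass δ(t) := ∫₀^∞ k(t,x) dx satisfies the ordinary differential equation dδ(t)/dt = f(t) − V(δ(t)/L) · k(t,0) for t ∈ [0,T]. -/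
open MeasureTheory Set Function

noncomputable section

/-- The bathtub kernel `w(y) = (1/L)·1_{[0,L]}(y)`. -/
def bathtubKernel (L : ℝ) : ℝ → ℝ :=
  (Set.Icc (0:ℝ) L).indicator fun _ => 1 / L

/-- Assumption 2: constant kernel data; `V` bounded, Lipschitz and nonnegative;
`k̄` C² smooth, nonnegative, supported on `[0,L]`; `φ` C² smooth, nonnegative,
supported (in space) on `[0,L]`, with unit mass and `φ(t,0) > 0` for `t∈[0,T]`. -/
structure Assumption2 (T L : ℝ) (V kbar : ℝ → ℝ) (phi : ℝ → ℝ → ℝ) : Prop where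
  hT : 0 < T
  hL : 0 < L
  V_bdd : ∃ M : ℝ, ∀ s : ℝ, |V s| ≤ M
  V_lip : ∃ K : NNReal, LipschitzWith K V
  V_nonneg : ∀ s : ℝ, 0 ≤ s → 0 ≤ V s
  kbar_smooth : ContDiff ℝ 2 kbar
  kbar_nonneg : ∀ x : ℝ, 0 ≤ x → 0 ≤ kbar x
  kbar_supp : ∀ x : ℝ, L < x → kbar x = 0
  phi_smooth : ContDiff ℝ 2 (uncurry phi)
  phi_nonneg : ∀ t x : ℝ, 0 ≤ t → 0 ≤ x → 0 ≤ phi t x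
  phi_supp : ∀ t x : ℝ, L < x → phi t x = 0
  phi_total : ∀ t ∈ Icc (0:ℝ) T, (∫ x in Ici (0:ℝ), phi t x) = 1
  phi_pos : ∀ t ∈ Icc (0:ℝ) T, 0 < phi t 0

/-- A strong solution of the generalized bathtub model on `[0,T]×[0,∞)` with the
kernel `w = (1/L)·1_{[0,L]}`. -/
def IsStrongSolutionT (T L : ℝ) (V f kbar : ℝ → ℝ) (phi : ℝ → ℝ → ℝ)
    (k : ℝ → ℝ → ℝ) : Prop :=
  (∃ K : NNReal, LipschitzOnWith K (uncurry k) (Icc 0 T ×ˢ Ici 0)) ∧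
  (∀ t ∈ Icc (0:ℝ) T, ∀ x ∈ Ici (0:ℝ), 0 ≤ k t x) ∧
  (∀ x ∈ Ici (0:ℝ), k 0 x = kbar x) ∧
  (∀ t ∈ Icc (0:ℝ) T, ∀ x ∈ Ici (0:ℝ), ∃ kt kx : ℝ,
    HasDerivWithinAt (fun s => k s x) kt (Icc 0 T) t ∧
    HasDerivWithinAt (fun y => k t y) kx (Ici 0) x ∧
    kt - V (∫ y in Ici (0:ℝ), k t y * bathtubKernel L y) * kx = f t * phi t x)

/-- Lipschitz densities give continuous spatial slices. -/
theorem continuousOn_slice {T : ℝ} {k : ℝ → ℝ → ℝ} {K : NNReal}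
    (hk : LipschitzOnWith K (uncurry k) (Icc 0 T ×ˢ Ici 0)) {t : ℝ} (ht : t ∈ Icc 0 T) :
    ContinuousOn (k t) (Ici 0) := by
  have h : ContinuousOn (fun x : ℝ => (t, x)) (Ici 0) := by fun_prop
  exact hk.continuousOn.comp h fun x hx => ⟨ht, hx⟩

theorem intervalIntegrable_slice {T : ℝ} {k : ℝ → ℝ → ℝ} {K : NNReal}
    (hk : LipschitzOnWith K (uncurry k) (Icc 0 T ×ˢ Ici 0)) {t : ℝ} (ht : t ∈ Icc 0 T)
    {a b : ℝ} (ha : 0 ≤ a) (hb : 0 ≤ b) : IntervalIntegrable (k t) volume a b :=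
  ((continuousOn_slice hk ht).mono fun _ hx => (le_inf ha hb).trans hx.1).intervalIntegrable

/-- Mass balance over a fixed interval for a Lipschitz solution of `∂ₜk - v ∂ₓk = g`. -/
theorem hasDerivWithinAt_integral_of_transport {T : ℝ} {k : ℝ → ℝ → ℝ} {K : NNReal}
    (hk : LipschitzOnWith K (uncurry k) (Icc 0 T ×ˢ Ici 0)) {t v : ℝ} {g : ℝ → ℝ}
    (ht : t ∈ Icc 0 T) (hg : Continuous g)
    (hpde : ∀ x ∈ Ici (0 : ℝ), ∃ kt kx : ℝ,
      HasDerivWithinAt (fun s => k s x) kt (Icc 0 T) t ∧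
      HasDerivWithinAt (fun y => k t y) kx (Ici 0) x ∧ kt - v * kx = g x)
    {a b : ℝ} (ha : 0 ≤ a) (hab : a ≤ b) :
    HasDerivWithinAt (fun s => ∫ x in a..b, k s x)
      (v * (k t b - k t a) + ∫ x in a..b, g x) (Icc 0 T) t := by
  have hb := ha.trans hab
  have hderiv : ∀ x, 0 < x → HasDerivAt (k t) (deriv (k t) x) x ∧
      HasDerivWithinAt (fun s => k s x) (v * deriv (k t) x + g x) (Icc 0 T) t := by
    intro x hx
    obtain ⟨kt, kx, h1, h2, h3⟩ := hpde x hx.le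
    have h2' : HasDerivAt (k t) kx x := h2.hasDerivAt (Ici_mem_nhds hx)
    rw [h2'.deriv, show v * kx + g x = kt by linarith]
    exact ⟨h2', h1⟩
  have hbound : ∀ x, 0 < x → ‖deriv (k t) x‖ ≤ K := by
    intro x hx
    refine norm_deriv_le_of_lip' K.2 ?_
    filter_upwards [Ici_mem_nhds hx] with y hy
    simpa [dist_eq_norm, Prod.dist_eq] using
      hk.dist_le_mul (t, y) ⟨ht, hy⟩ (t, x) ⟨ht, hx.le⟩
  have hint : IntervalIntegrable (deriv (k t)) volume a b := by
    refine (intervalIntegrable_const (c := (K : ℝ))).mono_fun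
      (measurable_deriv _).aestronglyMeasurable ?_
    refine (ae_restrict_iff' measurableSet_uIoc).2 (Filter.Eventually.of_forall fun x hx => ?_)
    rw [uIoc_of_le hab] at hx
    simpa using hbound x (ha.trans_lt hx.1)
  have hftc : ∫ x in a..b, deriv (k t) x = k t b - k t a :=
    intervalIntegral.integral_eq_sub_of_hasDerivAt_of_le hab
      ((continuousOn_slice hk ht).mono fun x hx => ha.trans hx.1)
      (fun x hx => (hderiv x (ha.trans_lt hx.1)).1) hint
  have hrw : v * (k t b - k t a) + ∫ x in a..b, g x
      = ∫ x in a..b, (v * deriv (k t) x + g x) := by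
    rw [intervalIntegral.integral_add (hint.const_mul v) (hg.intervalIntegrable a b),
      intervalIntegral.integral_const_mul, hftc]
  rw [hrw, hasDerivWithinAt_iff_tendsto_slope]
  have hmem : ∀ᶠ s in nhdsWithin t (Icc 0 T \ {t}), s ∈ Icc 0 T \ {t} := self_mem_nhdsWithin
  have hconv : Filter.Tendsto (fun s => ∫ x in a..b, slope (fun r => k r x) t s)
      (nhdsWithin t (Icc 0 T \ {t})) (nhds (∫ x in a..b, (v * deriv (k t) x + g x))) := by
    refine intervalIntegral.tendsto_integral_filter_of_dominated_convergence (fun _ => (K : ℝ))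
      ?_ ?_ intervalIntegrable_const ?_
    · filter_upwards [hmem] with s hs
      simp only [slope_def_field]
      exact ((intervalIntegrable_slice hk hs.1 ha hb).sub
        (intervalIntegrable_slice hk ht ha hb)).div_const _ |>.aestronglyMeasurable_restrict_uIoc
    · filter_upwards [hmem] with s hs
      refine Filter.Eventually.of_forall fun x hx => ?_
      rw [uIoc_of_le hab] at hx
      have hx0 : (0 : ℝ) ≤ x := ha.trans hx.1.le
      have h := hk.dist_le_mul (s, x) ⟨hs.1, hx0⟩ (t, x) ⟨ht, hx0⟩
      rw [slope_def_field, norm_div,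
        div_le_iff₀ (norm_pos_iff.2 (sub_ne_zero.2 (by simpa using hs.2)))]
      simpa [dist_eq_norm, Prod.dist_eq] using h
    · refine Filter.Eventually.of_forall fun x hx => ?_
      rw [uIoc_of_le hab] at hx
      exact hasDerivWithinAt_iff_tendsto_slope.1 (hderiv x (ha.trans_lt hx.1)).2
  refine hconv.congr' ?_
  filter_upwards [hmem] with s hs
  simp only [slope_def_field]
  rw [intervalIntegral.integral_div, intervalIntegral.integral_sub
    (intervalIntegrable_slice hk hs.1 ha hb) (intervalIntegrable_slice hk ht ha hb)]

/-- The contribution of a linearly moving endpoint. -/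
theorem hasDerivWithinAt_integral_moving_endpoint {T : ℝ} {k : ℝ → ℝ → ℝ} {K : NNReal}
    (hk : LipschitzOnWith K (uncurry k) (Icc 0 T ×ˢ Ici 0)) {t c M : ℝ} {S : Set ℝ}
    (ht : t ∈ S) (hS : S ⊆ Icc 0 T) (hM : 0 ≤ M) (hpos : ∀ s ∈ S, 0 ≤ c - M * s) :
    HasDerivWithinAt (fun s => ∫ x in (c - M * t)..(c - M * s), k s x)
      (-M * k t (c - M * t)) S t := by
  rw [hasDerivWithinAt_iff_isLittleO]
  have hbig : (fun s => (∫ x in (c - M * t)..(c - M * s), k s x)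
      - (∫ x in (c - M * t)..(c - M * t), k t x) - (s - t) • (-M * k t (c - M * t)))
      =O[nhdsWithin t S] fun s => (s - t) ^ 2 := by
    refine Asymptotics.IsBigO.of_bound (K * (1 + M) * M) ?_
    filter_upwards [self_mem_nhdsWithin] with s hs
    have hi := intervalIntegrable_slice hk (hS hs) (hpos t ht) (hpos s hs)
    have heq : (∫ x in (c - M * t)..(c - M * s), k s x)
        - (∫ x in (c - M * t)..(c - M * t), k t x) - (s - t) • (-M * k t (c - M * t))
        = ∫ x in (c - M * t)..(c - M * s), (k s x - k t (c - M * t)) := by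
      rw [intervalIntegral.integral_sub hi intervalIntegrable_const]
      simp only [intervalIntegral.integral_same, intervalIntegral.integral_const, smul_eq_mul]
      ring
    have hlen : |c - M * s - (c - M * t)| = M * |s - t| := by
      rw [show c - M * s - (c - M * t) = -(M * (s - t)) by ring, abs_neg, abs_mul,
        abs_of_nonneg hM]
    rw [heq]
    refine (intervalIntegral.norm_integral_le_of_norm_le_const
      (C := K * ((1 + M) * |s - t|)) fun x hx => ?_).trans_eq ?_
    · have hx' := uIoc_subset_uIcc hx
      have hx0 : (0 : ℝ) ≤ x := (le_inf (hpos t ht) (hpos s hs)).trans hx'.1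
      refine (hk.dist_le_mul (s, x) ⟨hS hs, hx0⟩ (t, c - M * t) ⟨hS ht, hpos t ht⟩).trans ?_
      gcongr
      have hxd := abs_sub_left_of_mem_uIcc hx'
      rw [hlen] at hxd
      rw [Prod.dist_eq, max_le_iff, Real.dist_eq, Real.dist_eq]
      constructor <;> nlinarith [abs_nonneg (s - t), mul_nonneg hM (abs_nonneg (s - t))]
    · rw [hlen, norm_pow, Real.norm_eq_abs]
      ring
  refine hbig.trans_isLittleO ?_
  have hlit : (fun s : ℝ => (s - t) ^ 2) =o[nhds t] fun s => s - t := by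
    simpa using Asymptotics.isLittleO_pow_sub_sub t (one_lt_two : 1 < 2)
  exact hlit.mono nhdsWithin_le_nhds

/-- A nonnegative Lipschitz solution of `∂ₜk - v ∂ₓk = g` with `0 ≤ v ≤ M` stays supported on
`[0, L]` if the initial data and the source are. -/
theorem transport_support {T L M : ℝ} {k g : ℝ → ℝ → ℝ} {v : ℝ → ℝ} {K : NNReal} (hL : 0 ≤ L)
    (hk : LipschitzOnWith K (uncurry k) (Icc 0 T ×ˢ Ici 0))
    (hnonneg : ∀ t ∈ Icc (0 : ℝ) T, ∀ x ∈ Ici (0 : ℝ), 0 ≤ k t x)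
    (hinit : ∀ x, L < x → k 0 x = 0)
    (hg : ∀ t, Continuous (g t)) (hg_supp : ∀ t x, L < x → g t x = 0)
    (hv : ∀ t ∈ Icc (0 : ℝ) T, 0 ≤ v t) (hvM : ∀ t, v t ≤ M) (hM : 0 ≤ M)
    (hpde : ∀ t ∈ Icc (0 : ℝ) T, ∀ x ∈ Ici (0 : ℝ), ∃ kt kx : ℝ,
      HasDerivWithinAt (fun s => k s x) kt (Icc 0 T) t ∧
      HasDerivWithinAt (fun y => k t y) kx (Ici 0) x ∧ kt - v t * kx = g t x)
    {t x : ℝ} (ht : t ∈ Icc (0 : ℝ) T) (hx : L < x) : k t x = 0 := by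
  set c := x + M * t with hc
  have hsub : Icc 0 t ⊆ Icc 0 T := Icc_subset_Icc_right ht.2
  have hend : ∀ s ∈ Icc 0 t, L < c - M * s := fun s hs => by
    nlinarith [mul_le_mul_of_nonneg_left hs.2 hM]
  have hvanish : ∀ h : ℝ → ℝ, (∀ y, L < y → h y = 0) → ∀ b, L ≤ b → ∫ y in L..b, h y = 0 := by
    intro h hh b hb
    refine (intervalIntegral.integral_congr_ae (Filter.Eventually.of_forall fun y hy => ?_)).trans
      intervalIntegral.integral_zero
    rw [uIoc_of_le hb] at hy
    exact hh y hy.1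
  have hderiv : ∀ s ∈ Icc 0 t, HasDerivWithinAt (fun r => ∫ y in L..(c - M * r), k r y)
      (v s * (k s (c - M * s) - k s L) - M * k s (c - M * s)) (Icc 0 t) s := by
    intro s hs
    have h1 := (hasDerivWithinAt_integral_of_transport hk (hsub hs) (hg s) (hpde s (hsub hs))
      hL (hend s hs).le).mono hsub
    have h2 := hasDerivWithinAt_integral_moving_endpoint hk hs hsub hM
      fun r hr => hL.trans (hend r hr).le
    rw [hvanish _ (hg_supp s) _ (hend s hs).le] at h1
    refine ((h1.add h2).congr_deriv (by ring)).congr_of_mem (fun r hr => ?_) hs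
    exact (intervalIntegral.integral_add_adjacent_intervals
      (intervalIntegrable_slice hk (hsub hr) hL (hL.trans (hend s hs).le))
      (intervalIntegrable_slice hk (hsub hr) (hL.trans (hend s hs).le)
        (hL.trans (hend r hr).le))).symm
  have hanti : AntitoneOn (fun r => ∫ y in L..(c - M * r), k r y) (Icc 0 t) := by
    refine antitoneOn_of_hasDerivWithinAt_nonpos (convex_Icc 0 t)
      (fun s hs => (hderiv s hs).continuousWithinAt)
      (fun s hs => (hderiv s (interior_subset hs)).mono interior_subset) fun s hs => ?_
    have hs' := interior_subset hs
    have h1 := hnonneg s (hsub hs') _ (hL.trans (hend s hs').le)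
    nlinarith [mul_le_mul_of_nonneg_right (hvM s) h1,
      mul_nonneg (hv s (hsub hs')) (hnonneg s (hsub hs') L hL)]
  have hle := hanti (left_mem_Icc.2 ht.1) (right_mem_Icc.2 ht.1) ht.1
  simp only [hvanish _ hinit _ (hend 0 (left_mem_Icc.2 ht.1)).le] at hle
  rw [show c - M * t = x by rw [hc]; ring] at hle
  by_contra hne
  have hpos : 0 < k t x := (hnonneg t ht x (hL.trans hx.le)).lt_of_ne (Ne.symm hne)
  refine hle.not_gt (intervalIntegral.integral_pos hx
    ((continuousOn_slice hk ht).mono fun y hy => hL.trans hy.1)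
    (fun y hy => hnonneg t ht y (hL.trans hy.1.le)) ⟨x, right_mem_Icc.2 hx.le, hpos⟩)

theorem integral_Ici_eq_intervalIntegral {L : ℝ} (hL : 0 ≤ L) {h : ℝ → ℝ}
    (hh : ∀ x, L < x → h x = 0) : ∫ x in Ici (0 : ℝ), h x = ∫ x in (0 : ℝ)..L, h x := by
  rw [intervalIntegral.integral_of_le hL, ← integral_Icc_eq_integral_Ioc]
  refine (setIntegral_eq_of_subset_of_forall_sdiff_eq_zero measurableSet_Ici
    (fun _ hx => hx.1) fun x hx => hh x ?_)
  exact not_le.1 fun hxL => hx.2 ⟨hx.1, hxL⟩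

theorem integral_mul_bathtubKernel {L : ℝ} (h : ℝ → ℝ) (hh : ∀ x, L < x → h x = 0) :
    ∫ y in Ici (0 : ℝ), h y * bathtubKernel L y = (∫ y in Ici (0 : ℝ), h y) / L := by
  rw [← integral_div]
  refine setIntegral_congr_fun measurableSet_Ici fun y hy => ?_
  by_cases hyL : y ≤ L
  · have hmem : y ∈ Icc (0 : ℝ) L := ⟨hy, hyL⟩
    simp [bathtubKernel, hmem, div_eq_mul_inv]
  · simp [hh y (not_le.1 hyL)]

theorem stmt9
    (T L : ℝ) (V f kbar : ℝ → ℝ) (phi : ℝ → ℝ → ℝ) (k : ℝ → ℝ → ℝ)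
    (hA : Assumption2 T L V kbar phi)
    (hf_meas : Measurable f)
    (hf : ∀ t ∈ Icc (0:ℝ) T, 0 ≤ f t) (hf_bdd : ∃ M : ℝ, ∀ t ∈ Icc (0:ℝ) T, f t ≤ M)
    (hk : IsStrongSolutionT T L V f kbar phi k) :
    -- the solution is supported on [0,T]×[0,L]
    (∀ t ∈ Icc (0:ℝ) T, ∀ x : ℝ, L < x → k t x = 0) ∧
    -- the total mass δ(t) = ∫₀^∞ k(t,x) dx satisfies δ' = f − V(δ/L) k(·,0)
    (∀ t ∈ Icc (0:ℝ) T,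
      HasDerivWithinAt (fun s => ∫ x in Ici (0:ℝ), k s x)
        (f t - V ((∫ x in Ici (0:ℝ), k t x) / L) * k t 0) (Icc 0 T) t) := by
  obtain ⟨⟨K, hlip⟩, hnonneg, hinit, hpde⟩ := hk
  obtain ⟨M, hM⟩ := hA.V_bdd
  have hL := hA.hL.le
  have hphi : ∀ t, Continuous (phi t) := fun t =>
    hA.phi_smooth.continuous.comp (Continuous.prodMk_right t)
  have hsource : ∀ t, Continuous fun x => f t * phi t x := fun t => (hphi t).const_mul (f t)
  have hkernel : ∀ t ∈ Icc (0:ℝ) T, 0 ≤ ∫ y in Ici (0:ℝ), k t y * bathtubKernel L y :=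
    fun t ht => setIntegral_nonneg measurableSet_Ici fun y hy =>
      mul_nonneg (hnonneg t ht y hy)
        (indicator_nonneg (fun _ _ => div_nonneg zero_le_one hL) y)
  have hsupp : ∀ t ∈ Icc (0:ℝ) T, ∀ x : ℝ, L < x → k t x = 0 := fun t ht x hx =>
    transport_support (M := M) (g := fun t x => f t * phi t x)
      (v := fun t => V (∫ y in Ici (0:ℝ), k t y * bathtubKernel L y)) hL hlip hnonneg
      (fun y hy => (hinit y (hL.trans hy.le)).trans (hA.kbar_supp y hy)) hsource
      (fun s y hy => by simp [hA.phi_supp s y hy])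
      (fun s hs => hA.V_nonneg _ (hkernel s hs)) (fun s => (le_abs_self _).trans (hM _))
      ((abs_nonneg _).trans (hM 0)) hpde ht hx
  refine ⟨hsupp, fun t ht => ?_⟩
  have hkL : k t L = 0 := by
    have hcont : ContinuousWithinAt (k t) (Ioi L) L :=
      (continuousOn_slice hlip ht L hL).mono fun y hy => hL.trans (le_of_lt hy)
    refine tendsto_nhds_unique hcont (tendsto_const_nhds.congr' ?_)
    filter_upwards [self_mem_nhdsWithin] with y hy
    exact (hsupp t ht y hy).symm
  have hderiv := hasDerivWithinAt_integral_of_transport hlip ht (hsource t) (hpde t ht) le_rfl hL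
  have hmass : ∫ x in (0:ℝ)..L, phi t x = 1 := by
    rw [← integral_Ici_eq_intervalIntegral hL (hA.phi_supp t), hA.phi_total t ht]
  rw [integral_mul_bathtubKernel _ (hsupp t ht), intervalIntegral.integral_const_mul, hmass,
    hkL] at hderiv
  exact (hderiv.congr_deriv (by ring)).congr_of_mem
    (fun s hs => integral_Ici_eq_intervalIntegral hL (hsupp s hs)) ht
end
end

section
/- Let Assumption 2 hold and f ∈ L^∞([0,T];[0,∞)), and let k be the strong solution of the generalized bathtub model with δ(t) := ∫₀^∞ k(t,x) dx, δ̄ := ∫₀^∞ k̄(x) dx, and v^δ(t) := V(δ(t)/L). Then δ satisfies the nonlinear Volterra integral equation of the second kind: δ(t) = (1/φ(t,0)) [ k(t,0) − k̄(∫₀ᵗ v^δ(τ) dτ) + δ̄ φ(0, ∫₀ᵗ v^δ(τ) dτ) ] − (1/φ(t,0)) ∫₀ᵗ [ v^δ(τ) k(τ,0) φ(τ, ∫_τ^t v^δ(τ̃) dτ̃) + v^δ(τ) δ(τ) ∂_x φ(τ, ∫_τ^t v^δ(τ̃) dτ̃) ] dτ + (1/φ(t,0)) ∫₀ᵗ δ(τ)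 ∂_t φ(τ, ∫_τ^t v^δ(τ̃) dτ̃) dτ, for all t ∈ [0,T]. -/
open MeasureTheory Set Function

noncomputable section

/-- The right-hand side of the nonlinear Volterra integral equation (3.5):
here `kb` is the boundary datum `t ↦ k(t,0)`, `δ` the unknown, and
`v^δ(s) = V(δ(s)/L)`. -/
def volterraRHS (L : ℝ) (V kbar : ℝ → ℝ) (phi : ℝ → ℝ → ℝ)
    (kb δ : ℝ → ℝ) (t : ℝ) : ℝ :=
  (1 / phi t 0) * (kb t - kbar (∫ τ in (0:ℝ)..t, V (δ τ / L))
      + (∫ x in Ici (0:ℝ), kbar x) * phi 0 (∫ τ in (0:ℝ)..t, V (δ τ / L)))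
  - (1 / phi t 0) * (∫ τ in (0:ℝ)..t,
      (V (δ τ / L) * kb τ * phi τ (∫ s in τ..t, V (δ s / L))
        + V (δ τ / L) * δ τ * deriv (phi τ) (∫ s in τ..t, V (δ s / L))))
  + (1 / phi t 0) * ∫ τ in (0:ℝ)..t,
      δ τ * deriv (fun s => phi s (∫ s' in τ..t, V (δ s' / L))) τ

/-- Leibniz rule for the mass of a Lipschitz transport solution on a fixed interval. -/
theorem hasDerivAt_integral_of_transport_s10 {u : ℝ → ℝ → ℝ} {K : NNReal}
    (hu : LipschitzWith K (uncurry u)) {g : ℝ → ℝ} (hg : Continuous g) {t c x : ℝ} (hx : 0 ≤ x)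
    (hpde : ∀ y, 0 < y → ∃ ut ux : ℝ,
      HasDerivAt (fun s => u s y) ut t ∧ HasDerivAt (u t) ux y ∧ ut - c * ux = g y) :
    HasDerivAt (fun s => ∫ y in (0:ℝ)..x, u s y)
      (c * (u t x - u t 0) + ∫ y in (0:ℝ)..x, g y) t := by
  have hspace : ∀ s, LipschitzWith K (u s) := fun s => by
    simpa [comp_def] using hu.comp (LipschitzWith.prodMk_left s)
  have htime : ∀ y, LipschitzWith K (fun s => u s y) := fun y => by
    simpa [comp_def] using hu.comp (LipschitzWith.prodMk_right y)
  have hderiv : ∀ y, 0 < y → HasDerivAt (u t) (deriv (u t) y) y := fun y hy => by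
    obtain ⟨ut, ux, -, h2, -⟩ := hpde y hy
    exact h2.differentiableAt.hasDerivAt
  have hint : IntervalIntegrable (deriv (u t)) volume 0 x := by
    refine IntervalIntegrable.mono_fun' (g := fun _ => (K : ℝ)) (by simp)
      (measurable_deriv _).aestronglyMeasurable ?_
    exact Filter.Eventually.of_forall fun y => norm_deriv_le_of_lipschitz (hspace t)
  have hftc : ∫ y in (0:ℝ)..x, deriv (u t) y = u t x - u t 0 :=
    intervalIntegral.integral_eq_sub_of_hasDerivAt_of_le hx (hspace t).continuous.continuousOn
      (fun y hy => hderiv y hy.1) hint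
  have key := (intervalIntegral.hasDerivAt_integral_of_dominated_loc_of_lip (μ := volume)
    (F := u) (F' := fun y => c * deriv (u t) y + g y) (x₀ := t) (a := 0) (b := x)
    (bound := fun _ => (K : ℝ)) (s := univ) Filter.univ_mem
    (Filter.Eventually.of_forall fun s => (hspace s).continuous.aestronglyMeasurable)
    ((hspace t).continuous.intervalIntegrable _ _)
    (((measurable_deriv _).const_mul c).add hg.measurable).aestronglyMeasurable
    (Filter.Eventually.of_forall fun y _ => by
      simpa using (htime y).lipschitzOnWith (s := univ))
    (by simp)
    (Filter.Eventually.of_forall fun y hy => by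
      rw [uIoc_of_le hx] at hy
      obtain ⟨ut, ux, h1, h2, h3⟩ := hpde y hy.1
      have h4 : c * deriv (u t) y + g y = ut := by rw [h2.deriv, ← h3]; ring
      rw [h4]; exact h1)).2
  rwa [intervalIntegral.integral_add (hint.const_mul c) (hg.intervalIntegrable _ _),
    intervalIntegral.integral_const_mul, hftc] at key

/-- Differentiating the mass to the left of a moving point does not need joint differentiability
of the Lipschitz density. -/
theorem hasDerivAt_integral_moving_endpoint {u : ℝ → ℝ → ℝ} {K : NNReal}
    (hu : LipschitzWith K (uncurry u)) {X : ℝ → ℝ} {t c m : ℝ} (hX : HasDerivAt X c t)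
    (hfix : HasDerivAt (fun s => ∫ y in (0:ℝ)..X t, u s y) m t) :
    HasDerivAt (fun s => ∫ y in (0:ℝ)..X s, u s y) (m + u t (X t) * c) t := by
  have hspace : ∀ s, Continuous (u s) := fun s =>
    hu.continuous.comp (Continuous.prodMk_right s)
  have hint : ∀ s a b, IntervalIntegrable (u s) volume a b := fun s a b =>
    (hspace s).intervalIntegrable _ _
  have hmain : HasDerivAt (fun s => ∫ y in (X t)..X s, u t y) (u t (X t) * c) t :=
    HasDerivAt.comp t (h₂ := fun z => ∫ y in (X t)..z, u t y)
      (intervalIntegral.integral_hasDerivAt_right (hint _ _ _)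
        ((hspace t).stronglyMeasurableAtFilter _ _) (hspace t).continuousAt) hX
  have herr : HasDerivAt (fun s => ∫ y in (X t)..X s, (u s y - u t y)) 0 t := by
    rw [hasDerivAt_iff_isLittleO]
    have hO : (fun s => ∫ y in (X t)..X s, (u s y - u t y)) =O[nhds t]
        fun s => (s - t) * (X s - X t) := by
      refine Asymptotics.IsBigO.of_bound K (Filter.Eventually.of_forall fun s => ?_)
      refine (intervalIntegral.norm_integral_le_of_norm_le_const (C := K * |s - t|)
        fun y _ => ?_).trans_eq ?_
      · have := (hu.comp (LipschitzWith.prodMk_right y)).dist_le_mul s t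
        simpa [Real.dist_eq] using this
      · rw [norm_mul, Real.norm_eq_abs, Real.norm_eq_abs]; ring
    have ho : (fun s => (s - t) * (X s - X t)) =o[nhds t] fun s => s - t := by
      have h0 : (fun s => X s - X t) =o[nhds t] fun _ => (1 : ℝ) := by
        rw [Asymptotics.isLittleO_one_iff]
        simpa using hX.continuousAt.tendsto.sub_const (X t)
      simpa using (Asymptotics.isBigO_refl (fun s => s - t) (nhds t)).mul_isLittleO h0
    simpa using hO.trans_isLittleO ho
  refine HasDerivAt.congr_deriv (f' := m + u t (X t) * c + 0) ?_ (add_zero _)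
  refine ((hfix.add hmain).add herr).congr_of_eventuallyEq (Filter.Eventually.of_forall ?_)
  · intro s
    simp only [Pi.add_apply]
    rw [intervalIntegral.integral_sub (hint _ _ _) (hint _ _ _), add_assoc, add_sub_cancel,
      intervalIntegral.integral_add_adjacent_intervals (hint _ _ _) (hint _ _ _)]

theorem hasDerivAt_integral_left {v : ℝ → ℝ} (hv : Continuous v) (s t : ℝ) :
    HasDerivAt (fun s => ∫ τ in s..t, v τ) (-v s) s :=
  intervalIntegral.integral_hasDerivAt_left (hv.intervalIntegrable _ _)
    (hv.stronglyMeasurableAtFilter _ _) hv.continuousAt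

theorem continuous_integral_left {v : ℝ → ℝ} (hv : Continuous v) (t : ℝ) :
    Continuous fun s => ∫ τ in s..t, v τ :=
  continuous_iff_continuousAt.2 fun s => (hasDerivAt_integral_left hv s t).continuousAt

theorem intervalIntegrable_bounded_mul {f g : ℝ → ℝ} (hf : Measurable f) {M : ℝ}
    (hM : ∀ s, |f s| ≤ M) (hg : Continuous g) (a b : ℝ) :
    IntervalIntegrable (fun s => f s * g s) volume a b := by
  refine IntervalIntegrable.mono_fun' (g := fun s => M * |g s|)
    ((continuous_const.mul hg.abs).intervalIntegrable _ _)
    (hf.mul hg.measurable).aestronglyMeasurable (Filter.Eventually.of_forall fun s => ?_)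
  simp only [norm_mul, Real.norm_eq_abs]
  exact mul_le_mul_of_nonneg_right (hM s) (abs_nonneg _)

/-- Lipschitz classical solutions of `∂ₜu - v(t) ∂ₓu = f(t) φ(t,x)` on `(0,T) × (0,∞)`, where the
velocity `v` is continuous and the time factor `f` of the source is only bounded measurable. -/
structure IsTransportSolution (T : ℝ) (v f : ℝ → ℝ) (phi u : ℝ → ℝ → ℝ) : Prop where
  lipschitz : ∃ K : NNReal, LipschitzWith K (uncurry u)
  continuous_velocity : Continuous v
  velocity_nonneg : ∀ s, 0 ≤ v s
  measurable_source : Measurable f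
  bounded_source : ∃ M : ℝ, ∀ s, |f s| ≤ M
  continuous_profile : Continuous (uncurry phi)
  pde : ∀ t ∈ Ioo 0 T, ∀ y, 0 < y → ∃ ut ux : ℝ,
    HasDerivAt (fun s => u s y) ut t ∧ HasDerivAt (u t) ux y ∧ ut - v t * ux = f t * phi t y

namespace IsTransportSolution

variable {T : ℝ} {v f : ℝ → ℝ} {phi u : ℝ → ℝ → ℝ}

theorem continuous (h : IsTransportSolution T v f phi u) : Continuous (uncurry u) :=
  h.lipschitz.choose_spec.continuous

theorem hasDerivAt_mass (h : IsTransportSolution T v f phi u) {s x : ℝ} (hs : s ∈ Ioo 0 T)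
    (hx : 0 ≤ x) :
    HasDerivAt (fun s => ∫ y in (0:ℝ)..x, u s y)
      (v s * (u s x - u s 0) + f s * ∫ y in (0:ℝ)..x, phi s y) s := by
  obtain ⟨K, hK⟩ := h.lipschitz
  rw [← intervalIntegral.integral_const_mul]
  exact hasDerivAt_integral_of_transport_s10 hK
    (continuous_const.mul (h.continuous_profile.comp (Continuous.prodMk_right s))) hx
    (h.pde s hs)

/-- Mass balance on the region to the left of a characteristic. -/
theorem mass_eq (h : IsTransportSolution T v f phi u) {t b : ℝ} (ht : t ∈ Icc 0 T)
    (hb : 0 ≤ b) :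
    ∫ y in (0:ℝ)..b, u t y = (∫ y in (0:ℝ)..(b + ∫ τ in (0:ℝ)..t, v τ), u 0 y)
      + ∫ s in (0:ℝ)..t, (-(v s * u s 0)
        + f s * ∫ y in (0:ℝ)..(b + ∫ τ in s..t, v τ), phi s y) := by
  obtain ⟨K, hK⟩ := h.lipschitz
  obtain ⟨M, hM⟩ := h.bounded_source
  have hXc : Continuous fun s => b + ∫ τ in s..t, v τ :=
    continuous_const.add (continuous_integral_left h.continuous_velocity t)
  have hder : ∀ s ∈ Ioo 0 t, HasDerivAt (fun s => ∫ y in (0:ℝ)..(b + ∫ τ in s..t, v τ), u s y)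
      (-(v s * u s 0) + f s * ∫ y in (0:ℝ)..(b + ∫ τ in s..t, v τ), phi s y) s := by
    intro s hs
    have hX : HasDerivAt (fun s => b + ∫ τ in s..t, v τ) (-v s) s :=
      (hasDerivAt_integral_left h.continuous_velocity s t).const_add b
    have hX0 : 0 ≤ b + ∫ τ in s..t, v τ := add_nonneg hb
      (intervalIntegral.integral_nonneg hs.2.le fun τ _ => h.velocity_nonneg τ)
    convert hasDerivAt_integral_moving_endpoint hK hX
      (h.hasDerivAt_mass ⟨hs.1, hs.2.trans_le ht.2⟩ hX0) using 1
    ring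
  have hc : Continuous fun s => ∫ y in (0:ℝ)..(b + ∫ τ in s..t, v τ), u s y :=
    intervalIntegral.continuous_parametric_intervalIntegral_of_continuous hK.continuous hXc
  have hint : IntervalIntegrable (fun s => -(v s * u s 0)
      + f s * ∫ y in (0:ℝ)..(b + ∫ τ in s..t, v τ), phi s y) volume 0 t := by
    refine IntervalIntegrable.add (Continuous.intervalIntegrable ?_ _ _)
      (intervalIntegrable_bounded_mul h.measurable_source hM ?_ _ _)
    · exact (h.continuous_velocity.mul (h.continuous.comp (Continuous.prodMk_left 0))).neg
    · exact intervalIntegral.continuous_parametric_intervalIntegral_of_continuous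
        h.continuous_profile hXc
  rw [intervalIntegral.integral_eq_sub_of_hasDerivAt_of_le ht.1 hc.continuousOn hder hint]
  simp

/-- Representation along characteristics (Duhamel's formula). -/
theorem eq_along_characteristic (h : IsTransportSolution T v f phi u) {t x : ℝ}
    (ht : t ∈ Icc 0 T) (hx : 0 ≤ x) :
    u t x = u 0 (x + ∫ τ in (0:ℝ)..t, v τ)
      + ∫ s in (0:ℝ)..t, f s * phi s (x + ∫ τ in s..t, v τ) := by
  obtain ⟨M, hM⟩ := h.bounded_source
  have hspace : ∀ s, Continuous (u s) := fun s => h.continuous.comp (Continuous.prodMk_right s)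
  have hprof : ∀ s, Continuous (phi s) := fun s =>
    h.continuous_profile.comp (Continuous.prodMk_right s)
  have hW := continuous_integral_left h.continuous_velocity t
  have hprim : ∀ (w : ℝ → ℝ), Continuous w → ∀ a b, HasDerivAt
      (fun b => ∫ y in (0:ℝ)..(b + a), w y) (w (b + a)) b := fun w hw a b =>
    (intervalIntegral.integral_hasDerivAt_right (hw.intervalIntegrable _ _)
      (hw.stronglyMeasurableAtFilter _ _) hw.continuousAt).comp_add_const b a
  have hFc : ∀ b, Continuous fun s => ∫ y in (0:ℝ)..(b + ∫ τ in s..t, v τ), phi s y :=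
    fun b => intervalIntegral.continuous_parametric_intervalIntegral_of_continuous
      h.continuous_profile (continuous_const.add hW)
  have hbc : Continuous fun s => -(v s * u s 0) :=
    (h.continuous_velocity.mul (h.continuous.comp (Continuous.prodMk_left 0))).neg
  obtain ⟨C, hC⟩ := (isCompact_Icc.prod isCompact_Icc : IsCompact
    (Icc 0 t ×ˢ Icc (x - 1) (x + 1))).exists_bound_of_continuousOn
    (f := fun p : ℝ × ℝ => phi p.1 (p.2 + ∫ τ in p.1..t, v τ))
    (h.continuous_profile.comp (continuous_fst.prodMk
      (continuous_snd.add (hW.comp continuous_fst)))).continuousOn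
  have hsource := (intervalIntegral.hasDerivAt_integral_of_dominated_loc_of_deriv_le
    (μ := volume) (a := 0) (b := t) (x₀ := x) (s := Icc (x - 1) (x + 1))
    (F := fun b s => -(v s * u s 0) + f s * ∫ y in (0:ℝ)..(b + ∫ τ in s..t, v τ), phi s y)
    (F' := fun b s => f s * phi s (b + ∫ τ in s..t, v τ)) (bound := fun _ => M * C)
    (Icc_mem_nhds (by linarith) (by linarith))
    (Filter.Eventually.of_forall fun b =>
      (hbc.measurable.add (h.measurable_source.mul (hFc b).measurable)).aestronglyMeasurable)
    ((hbc.intervalIntegrable _ _).add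
      (intervalIntegrable_bounded_mul h.measurable_source hM (hFc x) _ _))
    (h.measurable_source.mul (h.continuous_profile.comp
      (continuous_id.prodMk (continuous_const.add hW))).measurable).aestronglyMeasurable
    (Filter.Eventually.of_forall fun s hs b hb => by
      rw [uIoc_of_le ht.1] at hs
      rw [norm_mul]
      exact mul_le_mul (hM s) (hC (s, b) ⟨Ioc_subset_Icc_self hs, hb⟩) (norm_nonneg _)
        ((abs_nonneg _).trans (hM s)))
    (by simp)
    (Filter.Eventually.of_forall fun s _ b _ =>
      ((hprim _ (hprof s) _ b).const_mul (f s)).const_add _)).2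
  have hright := ((hprim _ (hspace 0) (∫ τ in (0:ℝ)..t, v τ) x).add hsource).hasDerivWithinAt
    (s := Ici x)
  have hleft : HasDerivWithinAt (fun b => ∫ y in (0:ℝ)..b, u t y) (u t x) (Ici x) x := by
    simpa using (hprim _ (hspace t) 0 x).hasDerivWithinAt
  refine (uniqueDiffOn_Ici x x self_mem_Ici).eq_deriv _ hleft (hright.congr_of_mem ?_ self_mem_Ici)
  exact fun b hb => h.mass_eq ht (hx.trans hb)

end IsTransportSolution

theorem hasDerivAt_fst_of_contDiff {phi : ℝ → ℝ → ℝ} (hphi : ContDiff ℝ 1 (uncurry phi))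
    (t x : ℝ) : HasDerivAt (fun s => phi s x) (fderiv ℝ (uncurry phi) (t, x) (1, 0)) t :=
  (hphi.differentiable one_ne_zero (t, x)).hasFDerivAt.comp_hasDerivAt t
    (f := fun s => (s, x)) ((hasDerivAt_id t).prodMk (hasDerivAt_const t x))

theorem hasDerivAt_snd_of_contDiff {phi : ℝ → ℝ → ℝ} (hphi : ContDiff ℝ 1 (uncurry phi))
    (t x : ℝ) : HasDerivAt (phi t) (fderiv ℝ (uncurry phi) (t, x) (0, 1)) x :=
  (hphi.differentiable one_ne_zero (t, x)).hasFDerivAt.comp_hasDerivAt x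
    (f := fun y => (t, y)) ((hasDerivAt_const x t).prodMk (hasDerivAt_id x))

theorem hasDerivAt_along_curve {phi : ℝ → ℝ → ℝ} (hphi : ContDiff ℝ 1 (uncurry phi))
    {X : ℝ → ℝ} {t c : ℝ} (hX : HasDerivAt X c t) :
    HasDerivAt (fun s => phi s (X s))
      (deriv (fun s => phi s (X t)) t + c * deriv (phi t) (X t)) t := by
  have h := (hphi.differentiable one_ne_zero (t, X t)).hasFDerivAt.comp_hasDerivAt t
    (f := fun s => (s, X s)) ((hasDerivAt_id t).prodMk hX)
  rw [(hasDerivAt_fst_of_contDiff hphi t (X t)).deriv,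
    (hasDerivAt_snd_of_contDiff hphi t (X t)).deriv]
  have hv : ((1 : ℝ), c) = (1, 0) + c • (0, 1) := by simp
  rw [hv, map_add, map_smul, smul_eq_mul] at h
  exact h

theorem continuous_deriv_fst {phi : ℝ → ℝ → ℝ} (hphi : ContDiff ℝ 1 (uncurry phi))
    {X : ℝ → ℝ} (hX : Continuous X) : Continuous fun t => deriv (fun s => phi s (X t)) t := by
  simp_rw [fun t => (hasDerivAt_fst_of_contDiff hphi t (X t)).deriv]
  exact ((hphi.continuous_fderiv one_ne_zero).comp (continuous_id.prodMk hX)).clm_apply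
    continuous_const

theorem continuous_deriv_snd {phi : ℝ → ℝ → ℝ} (hphi : ContDiff ℝ 1 (uncurry phi))
    {X : ℝ → ℝ} (hX : Continuous X) : Continuous fun t => deriv (phi t) (X t) := by
  simp_rw [fun t => (hasDerivAt_snd_of_contDiff hphi t (X t)).deriv]
  exact ((hphi.continuous_fderiv one_ne_zero).comp (continuous_id.prodMk hX)).clm_apply
    continuous_const

/-- The total mass of a transport solution vanishing at `L` satisfies a Volterra identity, obtained
from Duhamel's formula at `x = 0` by integrating the mass balance by parts. -/
theorem IsTransportSolution.volterra_identity {T L : ℝ} {v f : ℝ → ℝ} {phi u : ℝ → ℝ → ℝ}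
    (h : IsTransportSolution T v f phi u) (hphi : ContDiff ℝ 1 (uncurry phi)) (hL : 0 ≤ L)
    (huL : ∀ s ∈ Icc 0 T, u s L = 0) (hmass : ∀ s ∈ Icc 0 T, ∫ y in (0:ℝ)..L, phi s y = 1)
    {D : ℝ → ℝ} (hD : ∀ s, D s = ∫ y in (0:ℝ)..L, u s y) {t : ℝ} (ht : t ∈ Icc 0 T) :
    D t * phi t 0 = u t 0 - u 0 (∫ τ in (0:ℝ)..t, v τ) + D 0 * phi 0 (∫ τ in (0:ℝ)..t, v τ)
      - (∫ s in (0:ℝ)..t, (v s * u s 0 * phi s (∫ τ in s..t, v τ)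
          + v s * D s * deriv (phi s) (∫ τ in s..t, v τ)))
      + ∫ s in (0:ℝ)..t, D s * deriv (fun r => phi r (∫ τ in s..t, v τ)) s := by
  obtain ⟨M, hM⟩ := h.bounded_source
  obtain rfl : D = fun s => ∫ y in (0:ℝ)..L, u s y := funext hD
  set W : ℝ → ℝ := fun s => ∫ τ in s..t, v τ
  have hW : Continuous W := continuous_integral_left h.continuous_velocity t
  have hDc : Continuous fun s => ∫ y in (0:ℝ)..L, u s y :=
    intervalIntegral.continuous_parametric_intervalIntegral_of_continuous' h.continuous 0 L
  have hu0 : Continuous fun s => u s 0 := h.continuous.comp (Continuous.prodMk_left 0)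
  have hphiW : Continuous fun s => phi s (W s) :=
    hphi.continuous.comp (continuous_id.prodMk hW)
  have hflux : Continuous fun s => v s * u s 0 * phi s (W s)
      + v s * (∫ y in (0:ℝ)..L, u s y) * deriv (phi s) (W s) :=
    ((h.continuous_velocity.mul hu0).mul hphiW).add
      ((h.continuous_velocity.mul hDc).mul (continuous_deriv_snd hphi hW))
  have htime : Continuous fun s =>
      (∫ y in (0:ℝ)..L, u s y) * deriv (fun r => phi r (W s)) s :=
    hDc.mul (continuous_deriv_fst hphi hW)
  have hsource := intervalIntegrable_bounded_mul h.measurable_source hM hphiW 0 t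
  have hder : ∀ s ∈ Ioo 0 t, HasDerivAt (fun s => (∫ y in (0:ℝ)..L, u s y) * phi s (W s))
      (f s * phi s (W s) - (v s * u s 0 * phi s (W s)
        + v s * (∫ y in (0:ℝ)..L, u s y) * deriv (phi s) (W s))
        + (∫ y in (0:ℝ)..L, u s y) * deriv (fun r => phi r (W s)) s) s := by
    intro s hs
    have hsT : s ∈ Ioo 0 T := ⟨hs.1, hs.2.trans_le ht.2⟩
    refine ((h.hasDerivAt_mass hsT hL).mul (hasDerivAt_along_curve hphi
      (hasDerivAt_integral_left h.continuous_velocity s t))).congr_deriv ?_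
    rw [huL s (Ioo_subset_Icc_self hsT), hmass s (Ioo_subset_Icc_self hsT)]
    ring
  have hftc := intervalIntegral.integral_eq_sub_of_hasDerivAt_of_le ht.1
    (hDc.mul hphiW).continuousOn hder
    ((hsource.sub (hflux.intervalIntegrable _ _)).add (htime.intervalIntegrable _ _))
  rw [intervalIntegral.integral_add (hsource.sub (hflux.intervalIntegrable _ _))
    (htime.intervalIntegrable _ _),
    intervalIntegral.integral_sub hsource (hflux.intervalIntegrable _ _)] at hftc
  have hduhamel := h.eq_along_characteristic ht le_rfl
  simp only [zero_add] at hduhamel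
  have hWt : W t = 0 := intervalIntegral.integral_same
  simp only [Pi.mul_apply, hWt] at hftc
  change _ = _ - _ + _ * phi 0 (W 0) - _ + _
  linarith

theorem eq_zero_of_forall_gt {g : ℝ → ℝ} (hg : Continuous g) {L : ℝ}
    (h : ∀ x, L < x → g x = 0) {x : ℝ} (hx : L ≤ x) : g x = 0 := by
  have : EqOn g (fun _ => 0) (closure (Ioi L)) := EqOn.closure (fun y hy => h y hy) hg
    continuous_const
  rw [closure_Ioi] at this
  exact this hx

theorem setIntegral_Ici_eq_intervalIntegral {g : ℝ → ℝ} {L : ℝ} (hL : 0 ≤ L)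
    (h : ∀ x, L < x → g x = 0) : ∫ x in Ici (0:ℝ), g x = ∫ x in (0:ℝ)..L, g x := by
  rw [intervalIntegral.integral_of_le hL, ← integral_Icc_eq_integral_Ioc]
  refine setIntegral_eq_of_subset_of_forall_sdiff_eq_zero measurableSet_Ici Icc_subset_Ici_self ?_
  exact fun x hx => h x (lt_of_not_ge fun hxL => hx.2 ⟨hx.1, hxL⟩)

theorem setIntegral_mul_bathtubKernel {L : ℝ} (hL : 0 ≤ L) (g : ℝ → ℝ) :
    ∫ y in Ici (0:ℝ), g y * bathtubKernel L y = (∫ y in (0:ℝ)..L, g y) / L := by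
  rw [setIntegral_Ici_eq_intervalIntegral hL
    (fun x hx => by simp [bathtubKernel, hx]), ← intervalIntegral.integral_div]
  refine intervalIntegral.integral_congr fun y hy => ?_
  rw [uIcc_of_le hL] at hy
  simp [bathtubKernel, indicator_of_mem hy, div_eq_mul_inv]

/-- Extension of a function on `[0,T] × [0,∞)` to the plane by projection of the arguments. -/
def projExtend (T : ℝ) (k : ℝ → ℝ → ℝ) (t x : ℝ) : ℝ :=
  k (max 0 (min T t)) (max 0 x)

theorem projExtend_eq {T t x : ℝ} {k : ℝ → ℝ → ℝ} (ht : t ∈ Icc 0 T) (hx : 0 ≤ x) :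
    projExtend T k t x = k t x := by
  simp [projExtend, ht.1, ht.2, hx]

theorem lipschitzWith_projExtend {T : ℝ} (hT : 0 ≤ T) {k : ℝ → ℝ → ℝ} {K : NNReal}
    (hk : LipschitzOnWith K (uncurry k) (Icc 0 T ×ˢ Ici 0)) :
    LipschitzWith K (uncurry (projExtend T k)) := by
  have h1 : LipschitzWith 1 (fun p : ℝ × ℝ => (max 0 (min T p.1), max 0 p.2)) := by
    have := ((LipschitzWith.prod_fst (α := ℝ) (β := ℝ)).const_min T).const_max 0
    simpa using this.prodMk ((LipschitzWith.prod_snd (α := ℝ) (β := ℝ)).const_max 0)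
  have h2 := hk.comp (h1.lipschitzOnWith (s := univ))
    (fun p _ => ⟨⟨le_max_left _ _, max_le hT (min_le_left _ _)⟩, mem_Ici.2 (le_max_left _ _)⟩)
  rw [lipschitzOnWith_univ, mul_one] at h2
  exact h2

theorem IsStrongSolutionT.isTransportSolution {T L : ℝ} {V f kbar : ℝ → ℝ} {phi k : ℝ → ℝ → ℝ}
    (hA : Assumption2 T L V kbar phi) (hf_meas : Measurable f)
    (hf : ∀ t ∈ Icc (0:ℝ) T, 0 ≤ f t) (hf_bdd : ∃ M : ℝ, ∀ t ∈ Icc (0:ℝ) T, f t ≤ M)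
    (hk : IsStrongSolutionT T L V f kbar phi k) :
    IsTransportSolution T (fun t => V ((∫ y in (0:ℝ)..L, projExtend T k t y) / L))
      ((Icc 0 T).indicator f) phi (projExtend T k) := by
  obtain ⟨⟨K, hK⟩, hnonneg, -, hpde⟩ := hk
  have hLip := lipschitzWith_projExtend hA.hT.le hK
  refine ⟨⟨K, hLip⟩, ?_, fun s => hA.V_nonneg _ ?_, hf_meas.indicator measurableSet_Icc, ?_,
    hA.phi_smooth.continuous, ?_⟩
  · obtain ⟨_, hV⟩ := hA.V_lip
    exact hV.continuous.comp
      ((intervalIntegral.continuous_parametric_intervalIntegral_of_continuous'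
        hLip.continuous 0 L).div_const L)
  · exact div_nonneg (intervalIntegral.integral_nonneg hA.hL.le fun y _ =>
      hnonneg _ ⟨le_max_left _ _, max_le hA.hT.le (min_le_left _ _)⟩ _
        (mem_Ici.2 (le_max_left _ _))) hA.hL.le
  · obtain ⟨M, hM⟩ := hf_bdd
    refine ⟨M, fun s => ?_⟩
    by_cases hs : s ∈ Icc 0 T
    · rw [indicator_of_mem hs, abs_of_nonneg (hf s hs)]
      exact hM s hs
    · rw [indicator_of_notMem hs, abs_zero]
      have h0 : (0:ℝ) ∈ Icc 0 T := ⟨le_rfl, hA.hT.le⟩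
      exact (hf 0 h0).trans (hM 0 h0)
  · intro t ht y hy
    have htI := Ioo_subset_Icc_self ht
    obtain ⟨kt, kx, h1, h2, h3⟩ := hpde t htI y hy.le
    refine ⟨kt, kx, ?_, ?_, ?_⟩
    · refine (h1.hasDerivAt (Icc_mem_nhds ht.1 ht.2)).congr_of_eventuallyEq ?_
      filter_upwards [Icc_mem_nhds ht.1 ht.2] with s hs using projExtend_eq hs hy.le
    · refine (h2.hasDerivAt (Ici_mem_nhds hy)).congr_of_eventuallyEq ?_
      filter_upwards [Ici_mem_nhds hy] with z hz using projExtend_eq htI hz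
    · rw [indicator_of_mem htI, ← h3, setIntegral_mul_bathtubKernel hA.hL.le]
      congr 4
      refine intervalIntegral.integral_congr fun z hz => projExtend_eq htI ?_
      rw [uIcc_of_le hA.hL.le] at hz
      exact hz.1

/-- A strong solution stays supported on `[0,L]`. -/
theorem IsStrongSolutionT.eq_zero_of_le {T L : ℝ} {V f kbar : ℝ → ℝ} {phi k : ℝ → ℝ → ℝ}
    (hA : Assumption2 T L V kbar phi) (hf_meas : Measurable f)
    (hf : ∀ t ∈ Icc (0:ℝ) T, 0 ≤ f t) (hf_bdd : ∃ M : ℝ, ∀ t ∈ Icc (0:ℝ) T, f t ≤ M)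
    (hk : IsStrongSolutionT T L V f kbar phi k) {t x : ℝ} (ht : t ∈ Icc 0 T) (hx : L ≤ x) :
    k t x = 0 := by
  have h := IsStrongSolutionT.isTransportSolution hA hf_meas hf hf_bdd hk
  have hx0 : 0 ≤ x := hA.hL.le.trans hx
  have hshift : ∀ s ≤ t, L ≤ x + ∫ τ in s..t, V ((∫ y in (0:ℝ)..L, projExtend T k τ y) / L) :=
    fun s hs => hx.trans (le_add_of_nonneg_right
      (intervalIntegral.integral_nonneg hs fun τ _ => h.velocity_nonneg τ))
  rw [← projExtend_eq (k := k) ht hx0, h.eq_along_characteristic ht hx0,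
    projExtend_eq ⟨le_rfl, hA.hT.le⟩ (hA.hL.le.trans (hshift 0 ht.1)),
    hk.2.2.1 _ (hA.hL.le.trans (hshift 0 ht.1)),
    eq_zero_of_forall_gt hA.kbar_smooth.continuous hA.kbar_supp (hshift 0 ht.1), zero_add]
  refine intervalIntegral.integral_zero_ae (Filter.Eventually.of_forall fun s hs => ?_)
  rw [uIoc_of_le ht.1] at hs
  rw [eq_zero_of_forall_gt (g := phi s) (hA.phi_smooth.continuous.comp (Continuous.prodMk_right s))
    (hA.phi_supp s) (hshift s hs.2), mul_zero]

theorem volterraRHS_congr {T L : ℝ} {V kbar : ℝ → ℝ} {phi : ℝ → ℝ → ℝ} {b b' D D' : ℝ → ℝ}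
    (hb : EqOn b b' (Icc 0 T)) (hD : EqOn D D' (Icc 0 T)) {t : ℝ} (ht : t ∈ Icc 0 T) :
    volterraRHS L V kbar phi b D t = volterraRHS L V kbar phi b' D' t := by
  have hW : ∀ s ∈ Icc 0 t, ∫ τ in s..t, V (D τ / L) = ∫ τ in s..t, V (D' τ / L) := by
    intro s hs
    refine intervalIntegral.integral_congr fun τ hτ => ?_
    rw [uIcc_of_le hs.2] at hτ
    simp only [hD ⟨hs.1.trans hτ.1, hτ.2.trans ht.2⟩]
  unfold volterraRHS
  rw [hW 0 ⟨le_rfl, ht.1⟩, hb ht]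
  refine congrArg₂ (· + ·) (congrArg₂ (· - ·) rfl (congrArg₂ (· * ·) rfl ?_))
    (congrArg₂ (· * ·) rfl ?_)
  all_goals
    refine intervalIntegral.integral_congr fun s hs => ?_
    rw [uIcc_of_le ht.1] at hs
    simp only [hW s hs, hD ⟨hs.1, hs.2.trans ht.2⟩, hb ⟨hs.1, hs.2.trans ht.2⟩]

theorem stmt10
    (T L : ℝ) (V f kbar : ℝ → ℝ) (phi : ℝ → ℝ → ℝ) (k : ℝ → ℝ → ℝ)
    (hA : Assumption2 T L V kbar phi)
    (hf_meas : Measurable f)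
    (hf : ∀ t ∈ Icc (0:ℝ) T, 0 ≤ f t) (hf_bdd : ∃ M : ℝ, ∀ t ∈ Icc (0:ℝ) T, f t ≤ M)
    (hk : IsStrongSolutionT T L V f kbar phi k) :
    ∀ t ∈ Icc (0:ℝ) T,
      (∫ x in Ici (0:ℝ), k t x) =
        volterraRHS L V kbar phi (fun s => k s 0) (fun s => ∫ x in Ici (0:ℝ), k s x) t := by
  intro t ht
  have h := IsStrongSolutionT.isTransportSolution hA hf_meas hf hf_bdd hk
  have hsupp : ∀ s ∈ Icc 0 T, ∀ x, L ≤ x → k s x = 0 := fun s hs x hx =>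
    IsStrongSolutionT.eq_zero_of_le hA hf_meas hf hf_bdd hk hs hx
  have h0 : (0:ℝ) ∈ Icc 0 T := ⟨le_rfl, hA.hT.le⟩
  have hδ : EqOn (fun s => ∫ x in Ici (0:ℝ), k s x)
      (fun s => ∫ y in (0:ℝ)..L, projExtend T k s y) (Icc 0 T) := by
    intro s hs
    refine (setIntegral_Ici_eq_intervalIntegral hA.hL.le
      fun x hx => hsupp s hs x hx.le).trans ?_
    refine intervalIntegral.integral_congr fun y hy => (projExtend_eq hs ?_).symm
    rw [uIcc_of_le hA.hL.le] at hy
    exact hy.1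
  have hb : EqOn (fun s => k s 0) (fun s => projExtend T k s 0) (Icc 0 T) :=
    fun s hs => (projExtend_eq hs le_rfl).symm
  have hmass : ∀ s ∈ Icc 0 T, ∫ y in (0:ℝ)..L, phi s y = 1 := fun s hs => by
    rw [← setIntegral_Ici_eq_intervalIntegral hA.hL.le (hA.phi_supp s), hA.phi_total s hs]
  have hkbar : ∫ x in Ici (0:ℝ), kbar x = ∫ y in (0:ℝ)..L, projExtend T k 0 y := by
    refine Eq.trans ?_ (hδ h0)
    exact setIntegral_congr_fun measurableSet_Ici fun x hx => (hk.2.2.1 x hx).symm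
  have hinit : ∀ x, 0 ≤ x → kbar x = projExtend T k 0 x := fun x hx => by
    rw [projExtend_eq h0 hx, hk.2.2.1 x hx]
  have hid := h.volterra_identity (hA.phi_smooth.of_le (by norm_num)) hA.hL.le
    (fun s hs => by rw [projExtend_eq hs hA.hL.le, hsupp s hs L le_rfl]) hmass
    (D := fun s => ∫ y in (0:ℝ)..L, projExtend T k s y) (fun _ => rfl) ht
  rw [volterraRHS_congr hb hδ ht]
  refine (hδ ht).trans ?_
  beta_reduce
  rw [eq_div_of_mul_eq (hA.phi_pos t ht).ne' hid]
  unfold volterraRHS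
  rw [hkbar, hinit _ (intervalIntegral.integral_nonneg ht.1 fun τ _ => h.velocity_nonneg τ)]
  ring
end
end

section
/- Let Assumption 2 hold, let k(·,0) ∈ L^∞([0,T]) be given data, and define the successive approximations δ₀(t) = 0 and, for n ≥ 0, δ_{n+1}(t) = (1/φ(t,0)) [ k(t,0) − k̄(∫₀ᵗ v^{δ_n}(τ) dτ) + δ̄ φ(0, ∫₀ᵗ v^{δ_n}(τ) dτ) ] − (1/φ(t,0)) ∫₀ᵗ [ v^{δ_n}(τ) k(τ,0) φ(τ, ∫_τ^t v^{δ_n}(τ̃) dτ̃) + v^{δ_n}(τ) δ_n(τ) ∂_x φ(τ, ∫_τ^t v^{δ_n}(τ̃) dτ̃) ] dτ + (1/φ(t,0)) ∫₀ᵗ δ_n(τ) ∂_t φ(τ, ∫_τ^t v^{δ_n}(τ̃) dτ̃) dτ, where v^δ(t) := V(δ(t)/L). Then with C₁ := ‖k(·,0)‖_{L^∞} + ‖k̄‖_{L^∞} + δ̄‖φ‖_{L^∞} + T‖V‖_{L^∞}‖k(·,0)‖_{L^∞}‖φ‖_{L^∞}, C₂ := ‖V‖_{L^∞}‖∂_x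 φ‖_{L^∞} + ‖∂_t φ‖_{L^∞}, and φ_{min,0} := min_{t∈[0,T]} φ(t,0), one has |δ_n(t)| ≤ (C₁/φ_{min,0}) e^{(C₂/φ_{min,0}) t} for all n ≥ 0 and t ∈ [0,T]; in particular sup_{n≥0} ‖δ_n‖_{L^∞([0,T])} < ∞. -/
open MeasureTheory Set Function

noncomputable section

/-- The successive approximations (3.6): `δ₀ ≡ 0`,
`δ_{n+1} = volterraRHS applied to δ_n`. -/
def succApprox (L : ℝ) (V kbar : ℝ → ℝ) (phi : ℝ → ℝ → ℝ) (kb : ℝ → ℝ) :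
    ℕ → ℝ → ℝ
  | 0 => fun _ => 0
  | n + 1 => fun t => volterraRHS L V kbar phi kb (succApprox L V kbar phi kb n) t

/-- The primitive of `s ↦ c * exp (c * s)` vanishing at `0` is `t ↦ exp (c * t) - 1`. -/
theorem integral_mul_exp_mul (c t : ℝ) :
    ∫ s in (0:ℝ)..t, c * Real.exp (c * s) = Real.exp (c * t) - 1 := by
  have h : ∀ s ∈ uIcc 0 t, HasDerivAt (fun s => Real.exp (c * s)) (c * Real.exp (c * s)) s := by
    intro s _
    simpa [mul_comm] using ((hasDerivAt_id s).const_mul c).exp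
  rw [intervalIntegral.integral_eq_sub_of_hasDerivAt h (by
    apply Continuous.intervalIntegrable; fun_prop)]
  simp

/-- One step of the iteration: the right-hand side of the Volterra equation preserves the
exponential bound. -/
theorem abs_volterraRHS_le {T L : ℝ} {V kbar : ℝ → ℝ} {phi : ℝ → ℝ → ℝ} {kb δ : ℝ → ℝ}
    {Mk Mkbar MV Mphi Mpx Mpt phimin t : ℝ}
    (hkbar : 0 ≤ ∫ x in Ici (0:ℝ), kbar x)
    (hkb : ∀ t ∈ Icc (0:ℝ) T, |kb t| ≤ Mk)
    (hMkbar : ∀ x : ℝ, |kbar x| ≤ Mkbar)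
    (hMV : ∀ s : ℝ, |V s| ≤ MV)
    (hMphi : ∀ t ∈ Icc (0:ℝ) T, ∀ x : ℝ, |phi t x| ≤ Mphi)
    (hMpx : ∀ t ∈ Icc (0:ℝ) T, ∀ x : ℝ, |deriv (phi t) x| ≤ Mpx)
    (hMpt : ∀ t ∈ Icc (0:ℝ) T, ∀ x : ℝ, |deriv (fun s => phi s x) t| ≤ Mpt)
    (hphimin_pos : 0 < phimin)
    (hphimin : ∀ t ∈ Icc (0:ℝ) T, phimin ≤ phi t 0)
    {K c : ℝ}
    (hK : phimin * K =
      Mk + Mkbar + (∫ x in Ici (0:ℝ), kbar x) * Mphi + T * MV * Mk * Mphi)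
    (hc : phimin * c = MV * Mpx + Mpt)
    (hδ : ∀ s ∈ Icc (0:ℝ) T, |δ s| ≤ K * Real.exp (c * s)) (ht : t ∈ Icc (0:ℝ) T) :
    |volterraRHS L V kbar phi kb δ t| ≤ K * Real.exp (c * t) := by
  have h0 : (0:ℝ) ∈ Icc (0:ℝ) T := ⟨le_rfl, ht.1.trans ht.2⟩
  have hMk0 : 0 ≤ Mk := (abs_nonneg _).trans (hkb 0 h0)
  have hMV0 : 0 ≤ MV := (abs_nonneg _).trans (hMV 0)
  have hMphi0 : 0 ≤ Mphi := (abs_nonneg _).trans (hMphi 0 h0 0)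
  have hsub : ∀ s ∈ Ioc (0:ℝ) t, s ∈ Icc (0:ℝ) T := fun s hs => ⟨hs.1.le, hs.2.trans ht.2⟩
  have hpos : 0 < phi t 0 := hphimin_pos.trans_le (hphimin t ht)
  unfold volterraRHS
  set A := kb t - kbar (∫ τ in (0:ℝ)..t, V (δ τ / L))
      + (∫ x in Ici (0:ℝ), kbar x) * phi 0 (∫ τ in (0:ℝ)..t, V (δ τ / L))
  set B := ∫ τ in (0:ℝ)..t,
      (V (δ τ / L) * kb τ * phi τ (∫ s in τ..t, V (δ s / L))
        + V (δ τ / L) * δ τ * deriv (phi τ) (∫ s in τ..t, V (δ s / L)))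
  set D := ∫ τ in (0:ℝ)..t,
      δ τ * deriv (fun s => phi s (∫ s' in τ..t, V (δ s' / L))) τ
  have hAle : |A| ≤ Mk + Mkbar + (∫ x in Ici (0:ℝ), kbar x) * Mphi := by
    refine (abs_add_le _ _).trans (add_le_add ((abs_sub _ _).trans
      (add_le_add (hkb t ht) (hMkbar _))) ?_)
    rw [abs_mul, abs_of_nonneg hkbar]
    exact mul_le_mul_of_nonneg_left (hMphi 0 h0 _) hkbar
  have hint : IntervalIntegrable (fun s => K * Real.exp (c * s)) volume 0 t := by
    apply Continuous.intervalIntegrable; fun_prop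
  have hBle : |B| ≤ t * (MV * Mk * Mphi)
      + MV * Mpx * ∫ s in (0:ℝ)..t, K * Real.exp (c * s) := by
    have hrw : (∫ s in (0:ℝ)..t, (MV * Mk * Mphi + MV * Mpx * (K * Real.exp (c * s))))
        = t * (MV * Mk * Mphi) + MV * Mpx * ∫ s in (0:ℝ)..t, K * Real.exp (c * s) := by
      rw [intervalIntegral.integral_add (by simp) (hint.const_mul _)]
      simp only [intervalIntegral.integral_const, intervalIntegral.integral_const_mul,
        smul_eq_mul, sub_zero]
      ring
    rw [← hrw, ← Real.norm_eq_abs]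
    refine intervalIntegral.norm_integral_le_of_norm_le ht.1 (.of_forall fun s hs => ?_)
      (by apply Continuous.intervalIntegrable; fun_prop)
    have hs' := hsub s hs
    rw [Real.norm_eq_abs]
    refine (abs_add_le _ _).trans (add_le_add ?_ ?_)
    · rw [abs_mul, abs_mul]
      exact mul_le_mul (mul_le_mul (hMV _) (hkb s hs') (abs_nonneg _) hMV0)
        (hMphi s hs' _) (abs_nonneg _) (by positivity)
    · rw [abs_mul, abs_mul, mul_right_comm]
      exact mul_le_mul (mul_le_mul (hMV _) (hMpx s hs' _) (abs_nonneg _) hMV0)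
        (hδ s hs') (abs_nonneg _) (mul_nonneg hMV0 ((abs_nonneg _).trans (hMpx 0 h0 0)))
  have hDle : |D| ≤ Mpt * ∫ s in (0:ℝ)..t, K * Real.exp (c * s) := by
    rw [← intervalIntegral.integral_const_mul, ← Real.norm_eq_abs]
    refine intervalIntegral.norm_integral_le_of_norm_le ht.1 (.of_forall fun s hs => ?_)
      (hint.const_mul _)
    have hs' := hsub s hs
    rw [Real.norm_eq_abs, abs_mul, mul_comm]
    exact mul_le_mul (hMpt s hs' _) (hδ s hs') (abs_nonneg _)
      ((abs_nonneg _).trans (hMpt 0 h0 0))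
  have hT : t * (MV * Mk * Mphi) ≤ T * MV * Mk * Mphi := by
    have := mul_le_mul_of_nonneg_right ht.2 (by positivity : 0 ≤ MV * Mk * Mphi)
    linarith
  have hexp : phimin * (c * ∫ s in (0:ℝ)..t, K * Real.exp (c * s))
      = phimin * K * (Real.exp (c * t) - 1) := by
    rw [← integral_mul_exp_mul, intervalIntegral.integral_const_mul,
      intervalIntegral.integral_const_mul]
    ring
  have hsum : |A - B + D| ≤ phimin * (K * Real.exp (c * t)) := by
    have h1 : |A - B + D| ≤ |A| + |B| + |D| :=
      (abs_add_le _ _).trans (add_le_add (abs_sub _ _) le_rfl)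
    rw [← mul_assoc, hc] at hexp
    linarith
  have hbound : 0 ≤ K * Real.exp (c * t) := (abs_nonneg _).trans (hδ t ht)
  have hfac : 1 / phi t 0 * A - 1 / phi t 0 * B + 1 / phi t 0 * D = (A - B + D) / phi t 0 := by
    ring
  rw [hfac, abs_div, abs_of_pos hpos, div_le_iff₀ hpos, mul_comm _ (phi t 0)]
  exact hsum.trans (mul_le_mul_of_nonneg_right (hphimin t ht) hbound)

theorem stmt11
    (T L : ℝ) (V kbar : ℝ → ℝ) (phi : ℝ → ℝ → ℝ) (kb : ℝ → ℝ)
    (hA : Assumption2 T L V kbar phi)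
    -- observational data k(·,0) ∈ L^∞([0,T]) with ‖k(·,0)‖_{L^∞} ≤ Mk
    (Mk : ℝ) (hkb : ∀ t ∈ Icc (0:ℝ) T, |kb t| ≤ Mk)
    -- sup-norm bounds entering C₁ and C₂
    (Mkbar : ℝ) (hMkbar : ∀ x : ℝ, |kbar x| ≤ Mkbar)
    (MV : ℝ) (hMV : ∀ s : ℝ, |V s| ≤ MV)
    (Mphi : ℝ) (hMphi : ∀ t ∈ Icc (0:ℝ) T, ∀ x : ℝ, |phi t x| ≤ Mphi)
    (Mpx : ℝ) (hMpx : ∀ t ∈ Icc (0:ℝ) T, ∀ x : ℝ, |deriv (phi t) x| ≤ Mpx)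
    (Mpt : ℝ) (hMpt : ∀ t ∈ Icc (0:ℝ) T, ∀ x : ℝ, |deriv (fun s => phi s x) t| ≤ Mpt)
    -- φ_{min,0} := min_{t∈[0,T]} φ(t,0)
    (phimin : ℝ) (hphimin_pos : 0 < phimin)
    (hphimin : ∀ t ∈ Icc (0:ℝ) T, phimin ≤ phi t 0) :
    (∀ n : ℕ, ∀ t ∈ Icc (0:ℝ) T,
      |succApprox L V kbar phi kb n t| ≤
        ((Mk + Mkbar + (∫ x in Ici (0:ℝ), kbar x) * Mphi + T * MV * Mk * Mphi) / phimin) *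
          Real.exp (((MV * Mpx + Mpt) / phimin) * t)) ∧
    ∃ M : ℝ, ∀ n : ℕ, ∀ t ∈ Icc (0:ℝ) T, |succApprox L V kbar phi kb n t| ≤ M := by
  have hT := hA.hT
  have h0 : (0:ℝ) ∈ Icc (0:ℝ) T := ⟨le_rfl, hT.le⟩
  have hMk0 : 0 ≤ Mk := (abs_nonneg _).trans (hkb 0 h0)
  have hMkbar0 : 0 ≤ Mkbar := (abs_nonneg _).trans (hMkbar 0)
  have hMV0 : 0 ≤ MV := (abs_nonneg _).trans (hMV 0)
  have hMphi0 : 0 ≤ Mphi := (abs_nonneg _).trans (hMphi 0 h0 0)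
  have hMpx0 : 0 ≤ Mpx := (abs_nonneg _).trans (hMpx 0 h0 0)
  have hMpt0 : 0 ≤ Mpt := (abs_nonneg _).trans (hMpt 0 h0 0)
  have hkbar : 0 ≤ ∫ x in Ici (0:ℝ), kbar x :=
    setIntegral_nonneg measurableSet_Ici fun x hx => hA.kbar_nonneg x hx
  have key : ∀ n : ℕ, ∀ t ∈ Icc (0:ℝ) T,
      |succApprox L V kbar phi kb n t| ≤
        ((Mk + Mkbar + (∫ x in Ici (0:ℝ), kbar x) * Mphi + T * MV * Mk * Mphi) / phimin) *
          Real.exp (((MV * Mpx + Mpt) / phimin) * t) := by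
    intro n
    induction n with
    | zero =>
      intro t _
      simp only [succApprox, abs_zero]
      positivity
    | succ n ih =>
      intro t ht
      exact abs_volterraRHS_le hkbar hkb hMkbar hMV hMphi hMpx hMpt hphimin_pos hphimin
        (mul_div_cancel₀ _ hphimin_pos.ne') (mul_div_cancel₀ _ hphimin_pos.ne') ih ht
  refine ⟨key, ((Mk + Mkbar + (∫ x in Ici (0:ℝ), kbar x) * Mphi + T * MV * Mk * Mphi) / phimin) *
    Real.exp (((MV * Mpx + Mpt) / phimin) * T), fun n t ht => (key n t ht).trans ?_⟩
  have := ht.2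
  gcongr
end
end
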